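/- arXiv:1701.05182 — 4 statements merged into one kernel-verified Lean document; each statement's English description precedes it below -/
import Mathlib

section
/- Let n ≥ 2 and let ℰ be a map from n×n Hermitian complex matrices to m×m Hermitian complex matrices satisfying, for all Hermitian A, B and all p ∈ [0,1]: (1) ℰ(A) is Hermitian; (2) spec(ℰ(A)) = spec(A); (3) ℰ(pA + (1−p)B) = pℰ(A) + (1−p)ℰ(B). Then there exists a unique map ℰ' from all n×n complex matrices to m×m complex matrices such that ℰ'(H) = ℰ(H) for every Hermitian H and such that for all n×n matrices A, B and all x ∈ ℝ: ℰ'(1) = 1, ℰ'(A†) = ℰ'(A)†, ℰ'(A + B) = ℰ'(A) + ℰ'(B), ℰ'(AB) = ℰ'(A)ℰ'(B), and ℰ'(xA) = xℰ'(A). -/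
open scoped Matrix

namespace Matrix

/-- A convex-linear map on Hermitian matrices vanishing at `0` agrees there with a real-linear
map on all matrices. -/
theorem exists_linearMap_of_convex {ι V : Type*} [AddCommGroup V] [Module ℝ V]
    (E : Matrix ι ι ℂ → V) (h0 : E 0 = 0)
    (hconv : ∀ p : ℝ, 0 ≤ p → p ≤ 1 → ∀ A B : Matrix ι ι ℂ, A.IsHermitian → B.IsHermitian →
      E (p • A + (1 - p) • B) = p • E A + (1 - p) • E B) :
    ∃ F : Matrix ι ι ℂ →ₗ[ℝ] V, ∀ H : Matrix ι ι ℂ, H.IsHermitian → F H = E H := by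
  have hsmul : ∀ (c : ℝ) {A : Matrix ι ι ℂ}, A.IsHermitian → (c • A).IsHermitian := fun c A hA =>
    hA.smul (IsSelfAdjoint.all c)
  have hle : ∀ p : ℝ, 0 ≤ p → p ≤ 1 → ∀ A : Matrix ι ι ℂ, A.IsHermitian → E (p • A) = p • E A := by
    intro p hp hp' A hA
    simpa [h0] using hconv p hp hp' A 0 hA isHermitian_zero
  have hpos : ∀ p : ℝ, 0 ≤ p → ∀ A : Matrix ι ι ℂ, A.IsHermitian → E (p • A) = p • E A := by
    intro p hp A hA
    rcases le_total p 1 with hp' | hp'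
    · exact hle p hp hp' A hA
    · have hne : p ≠ 0 := by positivity
      have := hle p⁻¹ (by positivity) (inv_le_one_of_one_le₀ hp') (p • A) (hsmul p hA)
      rw [inv_smul_smul₀ hne] at this
      rw [this, smul_inv_smul₀ hne]
  have hadd : ∀ A B : Matrix ι ι ℂ, A.IsHermitian → B.IsHermitian → E (A + B) = E A + E B := by
    intro A B hA hB
    have := hconv (1 / 2) (by norm_num) (by norm_num) ((2 : ℝ) • A) ((2 : ℝ) • B)
      (hsmul 2 hA) (hsmul 2 hB)
    rw [hpos 2 (by norm_num) A hA, hpos 2 (by norm_num) B hB] at this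
    norm_num [smul_smul] at this
    exact this
  have hneg : ∀ A : Matrix ι ι ℂ, A.IsHermitian → E (-A) = -E A := by
    intro A hA
    have := hadd A (-A) hA hA.neg
    rw [add_neg_cancel, h0] at this
    exact (neg_eq_of_add_eq_zero_right this.symm).symm
  have hall : ∀ (p : ℝ) (A : Matrix ι ι ℂ), A.IsHermitian → E (p • A) = p • E A := by
    intro p A hA
    rcases le_total 0 p with hp | hp
    · exact hpos p hp A hA
    · have := hpos (-p) (by linarith) A hA
      rw [neg_smul, hneg _ (hsmul p hA), neg_smul] at this
      exact neg_injective this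
  refine ⟨{ toFun A := (2⁻¹ : ℝ) • E (A + Aᴴ), map_add' A B := ?_, map_smul' c A := ?_ },
    fun H hH => ?_⟩
  · rw [← smul_add, ← hadd _ _ (isHermitian_add_transpose_self A) (isHermitian_add_transpose_self B),
      conjTranspose_add, add_add_add_comm]
  · rw [conjTranspose_smul, star_trivial, ← smul_add, hall _ _ (isHermitian_add_transpose_self A),
      smul_comm, RingHom.id_apply]
  · change (2⁻¹ : ℝ) • E (H + Hᴴ) = E H
    rw [hH.eq, ← two_smul ℝ, hall _ _ hH, inv_smul_smul₀ two_ne_zero]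

section Encoding

variable {ι : Type*} [DecidableEq ι]

/-- The Hermitian matrix with entry `z` at `(i, j)` and `conj z` at `(j, i)`. -/
def hermUnit (i j : ι) (z : ℂ) : Matrix ι ι ℂ := single i j z + single j i (star z)

theorem isHermitian_hermUnit (i j : ι) (z : ℂ) : (hermUnit i j z).IsHermitian := by
  simp [hermUnit, IsHermitian, conjTranspose_add, conjTranspose_single, add_comm]

theorem isHermitian_single_one (i : ι) : (single i i (1 : ℂ)).IsHermitian := by
  simp [IsHermitian, conjTranspose_single]

theorem hermUnit_swap (i j : ι) (z : ℂ) : hermUnit j i (star z) = hermUnit i j z := by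
  simp [hermUnit, add_comm]

theorem hermUnit_add (i j : ι) (z w : ℂ) :
    hermUnit i j (z + w) = hermUnit i j z + hermUnit i j w := by
  simp only [hermUnit, star_add, single_add]
  abel

theorem hermUnit_smul (i j : ι) (c : ℝ) (z : ℂ) :
    hermUnit i j (c • z) = c • hermUnit i j z := by
  simp [hermUnit, smul_single]

section Blocks

variable {R : Type*} [Ring R] [Algebra ℝ R]

/-- The off-diagonal block of the image of `hermUnit i j z` under `F`. -/
noncomputable def jordanUnit (F : Matrix ι ι ℂ →ₗ[ℝ] R) (i j : ι) (z : ℂ) : R :=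
  F (single i i 1) * F (hermUnit i j z)

variable {F : Matrix ι ι ℂ →ₗ[ℝ] R}

theorem jordanUnit_eq_re_add_im (i j : ι) (z : ℂ) :
    jordanUnit F i j z = z.re • jordanUnit F i j 1 + z.im • jordanUnit F i j Complex.I := by
  have h : z = z.re • (1 : ℂ) + z.im • Complex.I := by apply Complex.ext <;> simp
  conv_lhs => rw [h, jordanUnit, hermUnit_add, hermUnit_smul, hermUnit_smul]
  simp [jordanUnit, mul_add]

theorem jordanUnit_neg (i j : ι) (z : ℂ) : jordanUnit F i j (-z) = -jordanUnit F i j z := by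
  rw [jordanUnit_eq_re_add_im, jordanUnit_eq_re_add_im (z := z)]
  simp only [Complex.neg_re, Complex.neg_im, neg_smul]
  abel

end Blocks

variable [Fintype ι]

theorem IsHermitian.isIdempotentElem_of_spectrum_eq {κ : Type*} [Fintype κ] [DecidableEq κ]
    {P : Matrix ι ι ℂ} {Q : Matrix κ κ ℂ}
    (hQ : Q.IsHermitian) (hPQ : spectrum ℂ Q = spectrum ℂ P) (hP : IsIdempotentElem P) :
    IsIdempotentElem Q := by
  refine (isIdempotentElem_iff_spectrum_subset ℝ Q hQ.isSelfAdjoint).2 fun x hx => ?_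
  have h : (x : ℂ) ∈ spectrum ℂ P := by
    rw [← hPQ]
    exact spectrum.algebraMap_mem ℂ hx
  simpa using hP.spectrum_subset ℂ h

theorem IsHermitian.eq_algebraMap_of_spectrum_subset {κ : Type*} [Fintype κ] [DecidableEq κ]
    {Q : Matrix κ κ ℂ}
    (hQ : Q.IsHermitian) (c : ℝ) (h : spectrum ℂ Q ⊆ {(c : ℂ)}) : Q = algebraMap ℝ _ c := by
  refine CFC.eq_algebraMap_of_spectrum_subset_singleton (R := ℝ) Q c (fun x hx => ?_)
    hQ.isSelfAdjoint
  simpa using h (spectrum.algebraMap_mem ℂ hx)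

section Jordan

variable {R : Type*} [Ring R] [Algebra ℝ R]

theorem map_mul_self_of_map_isIdempotentElem (F : Matrix ι ι ℂ →ₗ[ℝ] R)
    (hF : ∀ P : Matrix ι ι ℂ, P.IsHermitian → IsIdempotentElem P → IsIdempotentElem (F P))
    {A : Matrix ι ι ℂ} (hA : A.IsHermitian) : F (A * A) = F A * F A := by
  let Φ := Unitary.conjStarAlgAut ℂ (Matrix ι ι ℂ) hA.eigenvectorUnitary
  let P : ι → Matrix ι ι ℂ := fun i => Φ (single i i 1)
  have hPh : ∀ i, (P i).IsHermitian := fun i => by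
    change star (P i) = P i
    rw [← map_star]
    simp [P, star_eq_conjTranspose, conjTranspose_single]
  have hPP : ∀ i j, P i * P j = if i = j then P i else 0 := fun i j => by
    split_ifs with h
    · subst h
      simp [P, ← map_mul]
    · simp [P, ← map_mul, h]
  have hPi : ∀ i, IsIdempotentElem (F (P i)) := fun i =>
    hF _ (hPh i) (by simp [IsIdempotentElem, hPP])
  have horth : ∀ i j, i ≠ j → F (P i) * F (P j) = 0 := fun i j hij => by
    have h := hF (P i + P j) ((hPh i).add (hPh j))
      (by simp [IsIdempotentElem, add_mul, mul_add, hPP, hij, hij.symm])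
    rw [map_add] at h
    have : IsAddTorsionFree R := .of_isTorsionFree ℝ R
    exact (hPi i).mul_eq_zero_of_anticommute ((hPi i).add_iff (hPi j) |>.1 h)
  have hAP : A = ∑ i, hA.eigenvalues i • P i := by
    conv_lhs => rw [hA.spectral_theorem, ← sum_single_eq_diagonal, map_sum]
    refine Finset.sum_congr rfl fun i _ => ?_
    change Φ _ = hA.eigenvalues i • Φ _
    rw [← Complex.coe_smul, ← map_smul, smul_single]
    simp
  have hFA : F A = ∑ i, hA.eigenvalues i • F (P i) := by
    conv_lhs => rw [hAP]
    simp
  have hAA : A * A = ∑ i, (hA.eigenvalues i * hA.eigenvalues i) • P i := by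
    conv_lhs => rw [hAP]
    simp [Finset.sum_mul, Finset.mul_sum, hPP, smul_smul]
  have hFPP : ∀ i j, F (P i) * F (P j) = if i = j then F (P i) else 0 := fun i j => by
    split_ifs with h
    · rw [← h, (hPi i).eq]
    · exact horth i j h
  rw [hAA, hFA]
  simp [Finset.sum_mul, Finset.mul_sum, hFPP, smul_smul]

theorem map_anticommutator_of_map_mul_self (F : Matrix ι ι ℂ →ₗ[ℝ] R)
    (hF : ∀ A : Matrix ι ι ℂ, A.IsHermitian → F (A * A) = F A * F A)
    {A B : Matrix ι ι ℂ} (hA : A.IsHermitian) (hB : B.IsHermitian) :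
    F (A * B + B * A) = F A * F B + F B * F A := by
  have h := hF _ (hA.add hB)
  simp only [add_mul, mul_add, map_add, hF A hA, hF B hB] at h ⊢
  have e : ∀ x y z w : R, (x + y) + (z + w) - x - w = z + y := by intros; abel
  rw [← e (F A * F A) (F (B * A)), h, e]

theorem single_anticommutator_hermUnit {i j : ι} (hij : i ≠ j) (z : ℂ) :
    single i i 1 * hermUnit i j z + hermUnit i j z * single i i 1 = hermUnit i j z := by
  simp [hermUnit, mul_add, add_mul, hij, hij.symm]

theorem hermUnit_anticommutator_hermUnit {i j k : ι} (hij : i ≠ j) (hjk : j ≠ k) (hik : i ≠ k)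
    (z w : ℂ) : hermUnit i j z * hermUnit j k w + hermUnit j k w * hermUnit i j z =
      hermUnit i k (z * w) := by
  simp [hermUnit, mul_add, add_mul, hij, hij.symm, hjk, hjk.symm, hik, hik.symm, mul_comm]

theorem hermUnit_anticommutator_self {i j : ι} (hij : i ≠ j) (z w : ℂ) :
    hermUnit i j z * hermUnit i j w + hermUnit i j w * hermUnit i j z =
      (2 * (z * star w).re) • (single i i 1 + single j j 1) := by
  have h1 : ∀ k : ι, single k k (z * star w) + single k k (w * star z) =
      (2 * (z * star w).re) • single k k (1 : ℂ) := fun k => by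
    rw [← single_add, smul_single]
    congr 1
    apply Complex.ext <;> simp <;> ring
  rw [smul_add, ← h1 i, ← h1 j]
  simp [hermUnit, mul_add, add_mul, hij, hij.symm, mul_comm]
  abel

/-- The real star-algebra homomorphism determined by a self-adjoint system of matrix units and
a commuting copy of the complex numbers. -/
noncomputable def starAlgHomOfUnits [StarRing R] [StarModule ℝ R] (φ : ℂ →ₐ[ℝ] R) (u : ι → ι → R)
    (hφs : ∀ z, φ (star z) = star (φ z)) (hφu : ∀ z i j, Commute (φ z) (u i j))
    (hu1 : ∑ i, u i i = 1) (hu : ∀ i j k l, u i j * u k l = if j = k then u i l else 0)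
    (hus : ∀ i j, star (u i j) = u j i) : Matrix ι ι ℂ →⋆ₐ[ℝ] R :=
  have hone : ∑ i, ∑ j, φ ((1 : Matrix ι ι ℂ) i j) * u i j = 1 := by
    simp [one_apply, apply_ite φ, ite_mul, hu1]
  { toFun A := ∑ i, ∑ j, φ (A i j) * u i j
    map_one' := hone
    map_zero' := by simp
    map_add' A B := by simp [add_mul, Finset.sum_add_distrib]
    map_mul' A B := by
      have h : ∀ i j k l, φ (A i j) * u i j * (φ (B k l) * u k l) =
          if j = k then φ (A i j * B k l) * u i l else 0 := fun i j k l => by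
        rw [mul_assoc, ← mul_assoc (u i j), ← (hφu (B k l) i j).eq, mul_assoc (φ (B k l)), hu,
          ← mul_assoc, ← map_mul]
        split_ifs <;> simp
      simp_rw [mul_apply, map_sum, Finset.sum_mul, Finset.mul_sum, h]
      refine Finset.sum_congr rfl fun i _ => ?_
      rw [Finset.sum_comm]
      simp [Finset.sum_ite_irrel]
    commutes' r := by
      rw [Algebra.algebraMap_eq_smul_one, Algebra.algebraMap_eq_smul_one]
      conv_rhs => rw [← hone, Finset.smul_sum]
      simp [Finset.mul_sum, Algebra.smul_def, mul_assoc]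
    map_star' A := by
      simp only [star_apply, hφs, star_sum, star_mul, hus]
      rw [Finset.sum_comm]
      refine Finset.sum_congr rfl fun i _ => Finset.sum_congr rfl fun j _ => ?_
      rw [← hφs, (hφu _ _ _).eq] }

theorem starAlgHomOfUnits_single [StarRing R] [StarModule ℝ R] (φ : ℂ →ₐ[ℝ] R) (u : ι → ι → R)
    (hφs : ∀ z, φ (star z) = star (φ z)) (hφu : ∀ z i j, Commute (φ z) (u i j))
    (hu1 : ∑ i, u i i = 1) (hu : ∀ i j k l, u i j * u k l = if j = k then u i l else 0)
    (hus : ∀ i j, star (u i j) = u j i) (i j : ι) (z : ℂ) :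
    starAlgHomOfUnits φ u hφs hφu hu1 hu hus (single i j z) = φ z * u i j := by
  change ∑ k, ∑ l, φ (single i j z k l) * u k l = _
  simp [single_apply, apply_ite φ, ite_and]

section Units

variable {F : Matrix ι ι ℂ →ₗ[ℝ] R} (hF : ∀ A B : Matrix ι ι ℂ, A.IsHermitian → B.IsHermitian →
  F (A * B + B * A) = F A * F B + F B * F A)

include hF

theorem map_single_one_mul_self (i : ι) :
    F (single i i 1) * F (single i i 1) = F (single i i 1) := by
  have : IsAddTorsionFree R := .of_isTorsionFree ℝ R
  have h := hF _ _ (isHermitian_single_one i) (isHermitian_single_one i)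
  rw [single_mul_single_same, one_mul, map_add, ← two_nsmul, ← two_nsmul] at h
  exact (nsmul_right_injective two_ne_zero h).symm

theorem map_single_one_mul_of_ne {i j : ι} (hij : i ≠ j) :
    F (single i i 1) * F (single j j 1) = 0 := by
  have : IsAddTorsionFree R := .of_isTorsionFree ℝ R
  have h := hF _ _ (isHermitian_single_one i) (isHermitian_single_one j)
  refine IsIdempotentElem.mul_eq_zero_of_anticommute (map_single_one_mul_self hF i) ?_
  rw [← h]
  simp [hij, hij.symm]

theorem map_single_anticommutator_hermUnit {i j : ι} (hij : i ≠ j) (z : ℂ) :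
    F (single i i 1) * F (hermUnit i j z) + F (hermUnit i j z) * F (single i i 1) =
      F (hermUnit i j z) := by
  rw [← hF _ _ (isHermitian_single_one i) (isHermitian_hermUnit i j z),
    single_anticommutator_hermUnit hij]

theorem left_mul_jordanUnit (i j : ι) (z : ℂ) :
    F (single i i 1) * jordanUnit F i j z = jordanUnit F i j z := by
  rw [jordanUnit, ← mul_assoc, map_single_one_mul_self hF]

theorem jordanUnit_eq_map_hermUnit_mul {i j : ι} (hij : i ≠ j) (z : ℂ) :
    jordanUnit F i j z = F (hermUnit i j z) * F (single j j 1) := by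
  have h1 := congr_arg (· * F (single j j 1)) (map_single_anticommutator_hermUnit hF hij z)
  have h2 := congr_arg (F (single i i 1) * ·)
    (map_single_anticommutator_hermUnit hF hij.symm (star z))
  simp only [hermUnit_swap, add_mul, mul_add, mul_assoc, map_single_one_mul_of_ne hF hij,
    mul_zero, add_zero] at h1 h2
  rw [← mul_assoc, map_single_one_mul_of_ne hF hij, zero_mul, zero_add] at h2
  rw [jordanUnit, ← h1, h2]

theorem jordanUnit_mul_right {i j : ι} (hij : i ≠ j) (z : ℂ) :
    jordanUnit F i j z * F (single j j 1) = jordanUnit F i j z := by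
  rw [jordanUnit_eq_map_hermUnit_mul hF hij, mul_assoc, map_single_one_mul_self hF]

theorem map_hermUnit {i j : ι} (hij : i ≠ j) (z : ℂ) :
    F (hermUnit i j z) = jordanUnit F i j z + jordanUnit F j i (star z) := by
  rw [jordanUnit_eq_map_hermUnit_mul hF hij.symm, hermUnit_swap, jordanUnit,
    map_single_anticommutator_hermUnit hF hij]

theorem map_single_mul_map_hermUnit_of_ne {i j k : ι} (hij : i ≠ j) (hki : k ≠ i) (hkj : k ≠ j)
    (z : ℂ) : F (single k k 1) * F (hermUnit i j z) = 0 := by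
  rw [map_hermUnit hF hij, mul_add, ← left_mul_jordanUnit hF i, ← left_mul_jordanUnit hF j,
    ← mul_assoc, ← mul_assoc, map_single_one_mul_of_ne hF hki, map_single_one_mul_of_ne hF hkj]
  simp

theorem jordanUnit_mul_jordanUnit {i j k : ι} (hij : i ≠ j) (hjk : j ≠ k) (hik : i ≠ k)
    (z w : ℂ) : jordanUnit F i j z * jordanUnit F j k w = jordanUnit F i k (z * w) := by
  rw [jordanUnit, jordanUnit, jordanUnit, ← hermUnit_anticommutator_hermUnit hij hjk hik,
    hF _ _ (isHermitian_hermUnit i j z) (isHermitian_hermUnit j k w), mul_add, ← mul_assoc,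
    ← jordanUnit, jordanUnit_mul_right hF hij, jordanUnit, mul_assoc,
    ← mul_assoc _ (F (hermUnit j k w)), map_single_mul_map_hermUnit_of_ne hF hjk hij hik, zero_mul,
    add_zero]

theorem jordanUnit_mul_jordanUnit_add {i j : ι} (hij : i ≠ j) (z w : ℂ) :
    jordanUnit F i j z * jordanUnit F j i w + jordanUnit F i j (star w) * jordanUnit F j i (star z) =
      (2 * (z * w).re) • F (single i i 1) := by
  have e : ∀ a b : ℂ, jordanUnit F i j a * jordanUnit F j i b =
      F (single i i 1) * (F (hermUnit i j a) * F (hermUnit i j (star b))) := fun a b => by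
    have h : jordanUnit F j i b = F (single j j 1) * F (hermUnit i j (star b)) := by
      rw [jordanUnit, ← hermUnit_swap i j, star_star]
    rw [h, ← mul_assoc, jordanUnit_mul_right hF hij, jordanUnit, mul_assoc]
  rw [e, e, star_star, ← mul_add, ← hF _ _ (isHermitian_hermUnit i j _) (isHermitian_hermUnit i j _),
    hermUnit_anticommutator_self hij]
  rw [map_smul, map_add, mul_smul_comm, mul_add, map_single_one_mul_self hF,
    map_single_one_mul_of_ne hF hij, add_zero, star_star]

theorem jordanUnit_one_mul_one {i j : ι} (hij : i ≠ j) :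
    jordanUnit F i j 1 * jordanUnit F j i 1 = F (single i i 1) := by
  have : IsAddTorsionFree R := .of_isTorsionFree ℝ R
  have h := jordanUnit_mul_jordanUnit_add hF hij 1 1
  simp only [star_one, ← two_nsmul, mul_one, Complex.one_re, ofNat_smul_eq_nsmul] at h
  exact nsmul_right_injective two_ne_zero h

theorem jordanUnit_I_mul_I {i j : ι} (hij : i ≠ j) :
    jordanUnit F i j Complex.I * jordanUnit F j i Complex.I = -F (single i i 1) := by
  have : IsAddTorsionFree R := .of_isTorsionFree ℝ R
  have h := jordanUnit_mul_jordanUnit_add hF hij Complex.I Complex.I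
  simp only [Complex.star_def, Complex.conj_I, jordanUnit_neg, Complex.I_mul_I,
    Complex.neg_re, Complex.one_re, mul_neg, neg_mul, neg_neg, mul_one, neg_smul,
    ofNat_smul_eq_nsmul, ← smul_neg] at h
  rw [← two_nsmul] at h
  exact nsmul_right_injective two_ne_zero h

theorem jordanUnit_one_mul_I {i j : ι} (hij : i ≠ j) :
    jordanUnit F i j 1 * jordanUnit F j i Complex.I =
      jordanUnit F i j Complex.I * jordanUnit F j i 1 := by
  have h := jordanUnit_mul_jordanUnit_add hF hij 1 Complex.I
  simp only [Complex.star_def, Complex.conj_I, jordanUnit_neg, map_one, neg_mul, one_mul,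
    Complex.I_re, mul_zero, zero_smul] at h
  exact eq_of_sub_eq_zero (by rwa [sub_eq_add_neg])

theorem jordanUnit_I_mul_one_eq {i j k : ι} (hij : i ≠ j) (hik : i ≠ k) :
    jordanUnit F i j Complex.I * jordanUnit F j i 1 =
      jordanUnit F i k Complex.I * jordanUnit F k i 1 := by
  rcases eq_or_ne j k with rfl | hjk
  · rfl
  · have h1 := jordanUnit_mul_jordanUnit hF hjk hik.symm hij.symm 1 1
    have h2 := jordanUnit_mul_jordanUnit hF hij hjk hik Complex.I 1
    rw [mul_one] at h1 h2
    rw [← h1, ← mul_assoc, h2]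

theorem exists_imaginary_unit [Nontrivial ι] : ∃ J : R,
    (∀ i j, i ≠ j → J * F (single i i 1) = jordanUnit F i j Complex.I * jordanUnit F j i 1) ∧
    (∀ i j, i ≠ j → F (single i i 1) * J = jordanUnit F i j Complex.I * jordanUnit F j i 1) := by
  choose σ hσ using fun i : ι => exists_ne i
  refine ⟨∑ i, jordanUnit F i (σ i) Complex.I * jordanUnit F (σ i) i 1, fun i j hij => ?_,
    fun i j hij => ?_⟩
  · rw [jordanUnit_I_mul_one_eq hF hij (hσ i).symm, Finset.sum_mul, Finset.sum_eq_single i]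
    · rw [mul_assoc, jordanUnit_mul_right hF (hσ i)]
    · intro k _ hki
      rw [← jordanUnit_mul_right hF (hσ k), mul_assoc, mul_assoc, map_single_one_mul_of_ne hF hki,
        mul_zero, mul_zero]
    · simp
  · rw [jordanUnit_I_mul_one_eq hF hij (hσ i).symm, Finset.mul_sum, Finset.sum_eq_single i]
    · rw [← mul_assoc, left_mul_jordanUnit hF]
    · intro k _ hki
      rw [← left_mul_jordanUnit hF k, ← mul_assoc, ← mul_assoc,
        map_single_one_mul_of_ne hF hki.symm, zero_mul, zero_mul]
    · simp

variable (F) in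
/-- The images of the matrix units with entry `1` under the homomorphism extending `F`. -/
noncomputable def jordanMatrixUnit (i j : ι) : R :=
  if i = j then F (single i i 1) else jordanUnit F i j 1

theorem left_mul_jordanMatrixUnit (i j : ι) :
    F (single i i 1) * jordanMatrixUnit F i j = jordanMatrixUnit F i j := by
  unfold jordanMatrixUnit
  split_ifs
  · exact map_single_one_mul_self hF i
  · exact left_mul_jordanUnit hF i j 1

theorem jordanMatrixUnit_mul_right (i j : ι) :
    jordanMatrixUnit F i j * F (single j j 1) = jordanMatrixUnit F i j := by
  unfold jordanMatrixUnit
  split_ifs with h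
  · rw [h, map_single_one_mul_self hF]
  · exact jordanUnit_mul_right hF h 1

theorem jordanMatrixUnit_mul (i j k l : ι) :
    jordanMatrixUnit F i j * jordanMatrixUnit F k l =
      if j = k then jordanMatrixUnit F i l else 0 := by
  split_ifs with hjk
  · subst hjk
    rcases eq_or_ne i j with rfl | hij
    · conv_lhs => rw [jordanMatrixUnit, if_pos rfl, left_mul_jordanMatrixUnit hF]
    rcases eq_or_ne j l with rfl | hjl
    · conv_lhs => rw [jordanMatrixUnit.eq_1 F j j, if_pos rfl, jordanMatrixUnit_mul_right hF]
    rcases eq_or_ne i l with rfl | hil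
    · simp only [jordanMatrixUnit, if_neg hij, if_neg hjl, if_true, jordanUnit_one_mul_one hF hij]
    · simp only [jordanMatrixUnit, if_neg hij, if_neg hjl, if_neg hil,
        jordanUnit_mul_jordanUnit hF hij hjl hil, mul_one]
  · rw [← jordanMatrixUnit_mul_right hF, ← left_mul_jordanMatrixUnit hF k, mul_assoc,
      ← mul_assoc (F _), map_single_one_mul_of_ne hF hjk, zero_mul, mul_zero]

section ImaginaryUnit

variable {J : R}
  (hl : ∀ i j, i ≠ j → J * F (single i i 1) = jordanUnit F i j Complex.I * jordanUnit F j i 1)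
include hl

theorem imaginary_mul_jordanUnit_one {i j : ι} (hij : i ≠ j) :
    J * jordanUnit F i j 1 = jordanUnit F i j Complex.I := by
  rw [← left_mul_jordanUnit hF, ← mul_assoc, hl i j hij, mul_assoc,
    jordanUnit_one_mul_one hF hij.symm, jordanUnit_mul_right hF hij]

theorem imaginary_mul_self [Nontrivial ι] (h1 : F 1 = 1) : J * J = -1 := by
  rw [← mul_one (J * J), ← h1, ← sum_single_one, map_sum, Finset.mul_sum, ← Finset.sum_neg_distrib]
  refine Finset.sum_congr rfl fun i _ => ?_
  obtain ⟨j, hij⟩ := exists_ne i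
  rw [mul_assoc, hl i j hij.symm, ← mul_assoc, ← left_mul_jordanUnit hF, ← mul_assoc,
    hl i j hij.symm, mul_assoc (jordanUnit F i j Complex.I), jordanUnit_one_mul_I hF hij,
    ← mul_assoc, jordanUnit_I_mul_I hF hij.symm, mul_assoc, jordanUnit_one_mul_one hF hij.symm,
    neg_mul, map_single_one_mul_self hF]

theorem imaginary_commute_jordanMatrixUnit [Nontrivial ι]
    (hr : ∀ i j, i ≠ j → F (single i i 1) * J = jordanUnit F i j Complex.I * jordanUnit F j i 1)
    (i j : ι) : Commute J (jordanMatrixUnit F i j) := by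
  unfold jordanMatrixUnit
  split_ifs with hij
  · obtain ⟨k, hik⟩ := exists_ne i
    rw [commute_iff_eq, hl i k hik.symm, hr i k hik.symm]
  · rw [commute_iff_eq, imaginary_mul_jordanUnit_one hF hl hij, ← jordanUnit_mul_right hF hij 1,
      mul_assoc, hr j i (Ne.symm hij), ← mul_assoc, jordanUnit_one_mul_I hF hij, mul_assoc,
      jordanUnit_one_mul_one hF (Ne.symm hij), jordanUnit_mul_right hF hij]

end ImaginaryUnit

theorem star_jordanUnit [StarRing R] (hs : ∀ A : Matrix ι ι ℂ, A.IsHermitian → star (F A) = F A)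
    {i j : ι} (hij : i ≠ j) (z : ℂ) : star (jordanUnit F i j z) = jordanUnit F j i (star z) := by
  rw [jordanUnit_eq_map_hermUnit_mul hF hij.symm, hermUnit_swap, jordanUnit, star_mul,
    hs _ (isHermitian_single_one i), hs _ (isHermitian_hermUnit i j z)]

theorem star_jordanMatrixUnit [StarRing R]
    (hs : ∀ A : Matrix ι ι ℂ, A.IsHermitian → star (F A) = F A) (i j : ι) :
    star (jordanMatrixUnit F i j) = jordanMatrixUnit F j i := by
  rcases eq_or_ne i j with rfl | hij
  · simp only [jordanMatrixUnit, if_true, hs _ (isHermitian_single_one i)]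
  · simp only [jordanMatrixUnit, if_neg hij, if_neg hij.symm, star_jordanUnit hF hs hij, star_one]

theorem star_imaginary [StarRing R] [Nontrivial ι] (h1 : F 1 = 1)
    (hs : ∀ A : Matrix ι ι ℂ, A.IsHermitian → star (F A) = F A) {J : R}
    (hl : ∀ i j, i ≠ j → J * F (single i i 1) = jordanUnit F i j Complex.I * jordanUnit F j i 1) :
    star J = -J := by
  have h : J = ∑ i, J * F (single i i 1) := by
    rw [← Finset.mul_sum, ← map_sum, sum_single_one, h1, mul_one]
  rw [h, star_sum, ← Finset.sum_neg_distrib]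
  refine Finset.sum_congr rfl fun i _ => ?_
  obtain ⟨j, hij⟩ := exists_ne i
  rw [hl i j hij.symm, star_mul, star_jordanUnit hF hs hij, star_jordanUnit hF hs hij.symm,
    star_one, Complex.star_def, Complex.conj_I, jordanUnit_neg, mul_neg,
    jordanUnit_one_mul_I hF hij.symm]

/-- A unital Jordan map on Hermitian matrices of size at least two extends to a real
star-algebra homomorphism on all matrices. -/
theorem exists_starAlgHom_of_map_anticommutator [StarRing R] [StarModule ℝ R] [Nontrivial ι]
    (h1 : F 1 = 1) (hs : ∀ A : Matrix ι ι ℂ, A.IsHermitian → star (F A) = F A) :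
    ∃ Φ : Matrix ι ι ℂ →⋆ₐ[ℝ] R, ∀ A : Matrix ι ι ℂ, A.IsHermitian → Φ A = F A := by
  obtain ⟨J, hl, hr⟩ := exists_imaginary_unit hF
  have hJ := imaginary_mul_self hF hl h1
  have hJs := star_imaginary hF h1 hs hl
  let φ : ℂ →ₐ[ℝ] R := Complex.liftAux J hJ
  have hφ : ∀ z, φ z = algebraMap ℝ R z.re + z.im • J := Complex.liftAux_apply J hJ
  have hsum : ∑ i, jordanMatrixUnit F i i = 1 := by
    simp [jordanMatrixUnit, ← map_sum, sum_single_one, h1]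
  refine ⟨starAlgHomOfUnits φ (jordanMatrixUnit F) (fun z => ?_) (fun z i j => ?_) hsum
    (jordanMatrixUnit_mul hF) (star_jordanMatrixUnit hF hs), fun A hA => ?_⟩
  · simp [hφ, hJs, ← algebraMap_star_comm]
  · rw [hφ]
    exact (Algebra.commute_algebraMap_left _ _).add_left
      ((imaginary_commute_jordanMatrixUnit hF hl hr i j).smul_left _)
  · set Φ := starAlgHomOfUnits φ (jordanMatrixUnit F) _ _ _ _ _
    have hΦs : ∀ i j z, Φ (single i j z) = φ z * jordanMatrixUnit F i j :=
      starAlgHomOfUnits_single _ _ _ _ _ _ _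
    have hu : ∀ i j z, Φ (hermUnit i j z) = F (hermUnit i j z) := fun i j z => by
      rw [hermUnit, map_add, hΦs, hΦs]
      rcases eq_or_ne i j with rfl | hij
      · have e : single i i z + single i i (star z) = (2 * z.re) • single i i (1 : ℂ) := by
          rw [← single_add, smul_single]
          congr 1
          apply Complex.ext <;> simp
          ring
        rw [← add_mul, e, map_smul, jordanMatrixUnit, if_pos rfl, ← map_add, hφ]
        simp [Algebra.smul_def, two_mul]
      · have e : ∀ {i j}, i ≠ j → ∀ z, φ z * jordanMatrixUnit F i j = jordanUnit F i j z := by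
          intro i j hij z
          rw [jordanMatrixUnit, if_neg hij, hφ, add_mul, smul_mul_assoc,
            imaginary_mul_jordanUnit_one hF hl hij, ← Algebra.smul_def, ← jordanUnit_eq_re_add_im]
        rw [e hij, e hij.symm, ← map_hermUnit hF hij, hermUnit]
    have hA2 : A = (2⁻¹ : ℝ) • ∑ i, ∑ j, hermUnit i j (A i j) := by
      have e : ∑ i, ∑ j, single j i (star (A i j)) = A := by
        rw [Finset.sum_comm]
        conv_rhs => rw [matrix_eq_sum_single A]
        simp [hA.apply]
      simp only [hermUnit, Finset.sum_add_distrib, e, ← matrix_eq_sum_single]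
      rw [← two_smul ℝ, inv_smul_smul₀ two_ne_zero]
    rw [hA2]
    simp [hu]

end Units
end Jordan

theorem eq_of_eqOn_isHermitian [Nontrivial ι] {R : Type*} [Ring R] {f g : Matrix ι ι ℂ → R}
    (hfg : ∀ H : Matrix ι ι ℂ, H.IsHermitian → f H = g H)
    (hfa : ∀ A B, f (A + B) = f A + f B) (hga : ∀ A B, g (A + B) = g A + g B)
    (hfm : ∀ A B, f (A * B) = f A * f B) (hgm : ∀ A B, g (A * B) = g A * g B) : f = g := by
  have hoff : ∀ i j, i ≠ j → ∀ z, f (single i j z) = g (single i j z) := fun i j hij z => by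
    have e : single i j z = single i i 1 * hermUnit i j z := by
      simp [hermUnit, mul_add, hij]
    rw [e, hfm, hgm, hfg _ (isHermitian_single_one i), hfg _ (isHermitian_hermUnit i j z)]
  have hall : ∀ i j z, f (single i j z) = g (single i j z) := fun i j z => by
    rcases eq_or_ne i j with rfl | hij
    · obtain ⟨k, hk⟩ := exists_ne i
      have e : single i i z = single i k z * single k i 1 := by simp
      rw [e, hfm, hgm, hoff i k hk.symm, hoff k i hk]
    · exact hoff i j hij z
  have h : AddMonoidHom.mk' f hfa = AddMonoidHom.mk' g hga :=
    ext_addMonoidHom fun i j => AddMonoidHom.ext (hall i j)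
  exact funext fun A => DFunLike.congr_fun h A

end Encoding

end Matrix

/-- Any map on Hermitian matrices that is Hermiticity-preserving, spectrum-preserving and
convex-linear extends uniquely to a unital, adjoint-preserving, real-linear ring
homomorphism on all matrices. -/
theorem encoding_extends_to_unique_star_homomorphism
    {n m : ℕ} (hn : 2 ≤ n)
    (E : Matrix (Fin n) (Fin n) ℂ → Matrix (Fin m) (Fin m) ℂ)
    (hherm : ∀ A : Matrix (Fin n) (Fin n) ℂ, A.IsHermitian → (E A).IsHermitian)
    (hspec : ∀ A : Matrix (Fin n) (Fin n) ℂ, A.IsHermitian →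
      spectrum ℂ (E A) = spectrum ℂ A)
    (hconv : ∀ (p : ℝ), 0 ≤ p → p ≤ 1 → ∀ A B : Matrix (Fin n) (Fin n) ℂ,
      A.IsHermitian → B.IsHermitian →
      E (p • A + (1 - p) • B) = p • E A + (1 - p) • E B) :
    ∃! E' : Matrix (Fin n) (Fin n) ℂ → Matrix (Fin m) (Fin m) ℂ,
      (∀ H : Matrix (Fin n) (Fin n) ℂ, H.IsHermitian → E' H = E H) ∧
      E' 1 = 1 ∧
      (∀ A : Matrix (Fin n) (Fin n) ℂ, E' Aᴴ = (E' A)ᴴ) ∧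
      (∀ A B : Matrix (Fin n) (Fin n) ℂ, E' (A + B) = E' A + E' B) ∧
      (∀ A B : Matrix (Fin n) (Fin n) ℂ, E' (A * B) = E' A * E' B) ∧
      (∀ (x : ℝ) (A : Matrix (Fin n) (Fin n) ℂ), E' (x • A) = x • E' A) := by
  have : Nontrivial (Fin n) := Fin.nontrivial_iff_two_le.2 hn
  have h0 : E 0 = 0 := by
    simpa using (hherm 0 Matrix.isHermitian_zero).eq_algebraMap_of_spectrum_subset 0
      (by rw [hspec 0 Matrix.isHermitian_zero]; simp)
  have h1 : E 1 = 1 := by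
    simpa using (hherm 1 Matrix.isHermitian_one).eq_algebraMap_of_spectrum_subset 1
      (by rw [hspec 1 Matrix.isHermitian_one]; simp)
  obtain ⟨F, hF⟩ := Matrix.exists_linearMap_of_convex E h0 hconv
  have hsq : ∀ A : Matrix (Fin n) (Fin n) ℂ, A.IsHermitian → F (A * A) = F A * F A := fun A hA =>
    Matrix.map_mul_self_of_map_isIdempotentElem F (fun P hP hPP => by
      rw [hF P hP]
      exact (hherm P hP).isIdempotentElem_of_spectrum_eq (hspec P hP) hPP) hA
  obtain ⟨Φ, hΦ⟩ := Matrix.exists_starAlgHom_of_map_anticommutator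
    (fun A B => Matrix.map_anticommutator_of_map_mul_self F hsq)
    (by rw [hF 1 Matrix.isHermitian_one, h1])
    (fun A hA => by rw [hF A hA]; exact hherm A hA)
  have hΦE : ∀ H : Matrix (Fin n) (Fin n) ℂ, H.IsHermitian → Φ H = E H := fun H hH => by
    rw [hΦ H hH, hF H hH]
  refine ⟨Φ, ⟨hΦE, map_one Φ, map_star Φ, map_add Φ, map_mul Φ, map_smul Φ⟩, ?_⟩
  rintro G ⟨hGE, -, -, hGa, hGm, -⟩
  exact Matrix.eq_of_eqOn_isHermitian (fun H hH => by rw [hGE H hH, hΦE H hH]) hGa (map_add Φ)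
    hGm (map_mul Φ)
end

section
/- Let n ≥ 2 and let ℰ be a map from n×n Hermitian complex matrices to m×m Hermitian complex matrices satisfying, for all Hermitian A, B and all p ∈ [0,1]: (1) ℰ(A) is Hermitian; (2) spec(ℰ(A)) = spec(A); (3) ℰ(pA + (1−p)B) = pℰ(A) + (1−p)ℰ(B). Then there exist non-negative integers p, q with p + q ≥ 1 and (p+q)·n = m, and a unitary m×m matrix U, such that for every Hermitian n×n matrix M: ℰ(M) = U · (M^{⊕p} ⊕ M̄^{⊕q}) · U†, where M^{⊕p} ⊕ M̄^{⊕q} denotes the block-diagonal matrix with p diagonal blocks equal to M followed by q diagonal blocks equal to M̄. -/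
open scoped Matrix

/-- The relations satisfied by the images of the standard matrix units under a Jordan
homomorphism. -/
def IsJordanMatrixUnits {ι R : Type*} [DecidableEq ι] [Ring R] (f : ι → ι → R) : Prop :=
  ∀ i j k l, f i j * f k l + f k l * f i j =
    (if j = k then f i l else 0) + (if l = i then f k j else 0)

namespace IsJordanMatrixUnits

variable {ι R : Type*} [DecidableEq ι] [Ring R] {f : ι → ι → R}

lemma row_peirce (hf : IsJordanMatrixUnits f) {i j : ι} (hij : i ≠ j) :
    f i i * f i j + f i j * f i i = f i j := by
  simpa [hij.symm] using hf i i i j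

lemma col_peirce (hf : IsJordanMatrixUnits f) {i j : ι} (hij : i ≠ j) :
    f j j * f i j + f i j * f j j = f i j := by
  simpa [hij.symm] using hf j j i j

/-- The transposed family of a family of Jordan matrix units is again one. -/
lemma transpose (hf : IsJordanMatrixUnits f) : IsJordanMatrixUnits fun i j => f j i := by
  intro i j k l
  have h := hf j i l k
  simp only [eq_comm (a := i), eq_comm (a := k)] at h
  rw [h, add_comm]

variable [IsAddTorsionFree R]

lemma idem (hf : IsJordanMatrixUnits f) (i : ι) : f i i * f i i = f i i := by
  have h := hf i i i i
  simp only [if_true] at h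
  rw [← two_nsmul, ← two_nsmul] at h
  exact nsmul_right_injective (two_ne_zero) h

lemma sq_eq_zero (hf : IsJordanMatrixUnits f) {i j : ι} (hij : i ≠ j) : f i j * f i j = 0 := by
  have h := hf i j i j
  simp only [if_neg hij.symm, add_zero] at h
  exact self_eq_neg.mp (eq_neg_of_add_eq_zero_left h)

lemma mul_eq_zero_both (hf : IsJordanMatrixUnits f) {i j k : ι} (hi : k ≠ i) (hj : k ≠ j) :
    f k k * f i j = 0 ∧ f i j * f k k = 0 := by
  have h := hf k k i j
  simp only [if_neg hi, if_neg hj.symm, add_zero] at h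
  have e := hf.idem k
  have h1 : f k k * f i j + f k k * f i j * f k k = 0 := by
    have := congrArg (f k k * ·) h
    simpa [mul_add, ← mul_assoc, e] using this
  have h2 : f k k * f i j * f k k = 0 := by
    have := congrArg (· * f k k) h1
    simp only [add_mul, mul_assoc, e, zero_mul] at this
    rw [← mul_assoc] at this
    exact self_eq_neg.mp (eq_neg_of_add_eq_zero_left this)
  rw [h2, add_zero] at h1
  rw [h1, zero_add] at h
  exact ⟨h1, h⟩

lemma diag_mul_eq_zero (hf : IsJordanMatrixUnits f) {i j k : ι} (hi : k ≠ i) (hj : k ≠ j) :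
    f k k * f i j = 0 := (hf.mul_eq_zero_both hi hj).1

lemma mul_diag_eq_zero (hf : IsJordanMatrixUnits f) {i j k : ι} (hi : k ≠ i) (hj : k ≠ j) :
    f i j * f k k = 0 := (hf.mul_eq_zero_both hi hj).2

lemma diag_mul_mul_diag (hf : IsJordanMatrixUnits f) {i j : ι} (hij : i ≠ j) :
    f i i * f i j * f i i = 0 := by
  have := congrArg (f i i * ·) (hf.row_peirce hij)
  simp only [mul_add, ← mul_assoc, hf.idem i] at this
  exact add_eq_left.mp this

lemma col_diag_mul (hf : IsJordanMatrixUnits f) {i j : ι} (hij : i ≠ j) :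
    f j j * f i j = f i j * f i i := by
  have h0 : f j j * f i i = 0 := hf.diag_mul_eq_zero hij.symm hij.symm
  have h1 := congrArg (f j j * ·) (hf.row_peirce hij)
  have h2 := congrArg (· * f i i) (hf.col_peirce hij)
  simp only [mul_add, ← mul_assoc, h0, zero_mul, zero_add] at h1
  simp only [add_mul, mul_assoc, h0, mul_zero, add_zero] at h2
  rw [← h1, ← h2, ← mul_assoc]

lemma row_diag_mul (hf : IsJordanMatrixUnits f) {i j : ι} (hij : i ≠ j) :
    f i i * f i j = f i j * f j j := by
  have h1 := hf.row_peirce hij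
  have h2 := hf.col_peirce hij
  rw [hf.col_diag_mul hij, add_comm] at h2
  exact add_right_cancel (h1.trans h2.symm)

lemma corner_mul_col (hf : IsJordanMatrixUnits f) {a b j : ι} (hab : a ≠ b) (hj : j ≠ a) :
    f a b * f b b * f b a * f j a = 0 := by
  by_cases hb : j = b
  · subst hb
    rw [mul_assoc _ (f j a), hf.sq_eq_zero hj, mul_zero]
  · have h := hf b a j a
    simp only [if_neg hj.symm, if_neg hab, add_zero] at h
    rw [mul_assoc _ (f b a), eq_neg_of_add_eq_zero_left h, mul_neg, ← mul_assoc, mul_assoc (f a b),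
      hf.diag_mul_eq_zero (Ne.symm hb) hab.symm]
    simp

lemma row_mul_corner (hf : IsJordanMatrixUnits f) {a b j : ι} (hab : a ≠ b) (hj : j ≠ a) :
    f a j * (f a b * f b b * f b a) = 0 := by
  by_cases hb : j = b
  · subst hb
    simp only [← mul_assoc]
    rw [hf.sq_eq_zero hj.symm]; simp
  · have h := hf a j a b
    simp only [if_neg hj, if_neg hab.symm, add_zero] at h
    simp only [← mul_assoc]
    rw [eq_neg_of_add_eq_zero_left h, neg_mul, mul_assoc (f a b) (f a j),
      hf.mul_diag_eq_zero hab.symm (Ne.symm hb)]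
    simp

lemma corner_add_corner (hf : IsJordanMatrixUnits f) {a b : ι} (hab : a ≠ b) :
    f a b * f b b * f b a + f b a * f b b * f a b = f a a := by
  have h := hf a b b a
  simp only [if_true] at h
  rw [← hf.row_diag_mul hab, ← hf.col_diag_mul hab.symm, mul_assoc, mul_assoc, ← mul_add, h,
    mul_add, hf.idem, hf.diag_mul_eq_zero hab hab, add_zero]

lemma diag_mul_corner (hf : IsJordanMatrixUnits f) {a b : ι} (hab : a ≠ b) :
    f a a * (f a b * f b b * f b a) = f a b * f b b * f b a := by
  rw [← hf.row_diag_mul hab]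
  simp only [← mul_assoc, hf.idem]

lemma corner_mul_diag (hf : IsJordanMatrixUnits f) {a b : ι} (hab : a ≠ b) :
    f a b * f b b * f b a * f a a = f a b * f b b * f b a := by
  rw [mul_assoc (f a b), hf.row_diag_mul hab.symm, mul_assoc, mul_assoc, hf.idem]

lemma corner_mul_corner (hf : IsJordanMatrixUnits f) {a b : ι} (hab : a ≠ b) :
    f a b * f b b * f b a * (f b a * f b b * f a b) = 0 := by
  rw [mul_assoc (f b a), ← mul_assoc _ (f b a), hf.corner_mul_col hab hab.symm, zero_mul]

lemma corner_idem (hf : IsJordanMatrixUnits f) {a b : ι} (hab : a ≠ b) :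
    f a b * f b b * f b a * (f a b * f b b * f b a) = f a b * f b b * f b a := by
  have h := hf.corner_mul_diag hab
  rwa [← hf.corner_add_corner hab, mul_add, hf.corner_mul_corner hab, add_zero] at h

lemma corner_row_col_corner (hf : IsJordanMatrixUnits f) {a b : ι} (hab : a ≠ b) (i j : ι) :
    f a b * f b b * f b a * f a i * f j a * (f a b * f b b * f b a) =
      if i = j then f a b * f b b * f b a else 0 := by
  have hl := fun j (hj : j ≠ a) => hf.corner_mul_col hab hj
  have hr := fun j (hj : j ≠ a) => hf.row_mul_corner hab hj
  have hc := hf.corner_mul_diag hab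
  have hd := hf.diag_mul_corner hab
  have hq := hf.corner_idem hab
  set Q := f a b * f b b * f b a
  by_cases hi : i = a
  · subst hi
    rw [hc]
    by_cases hj : j = i
    · subst hj; rw [hc, hq]; simp
    · rw [hl j hj, zero_mul, if_neg (Ne.symm hj)]
  · by_cases hj : j = a
    · subst hj
      rw [mul_assoc, hd, mul_assoc, hr i hi, mul_zero, if_neg hi]
    · have h := hf a i j a
      simp only [if_true] at h
      have key : Q * f a i * f j a * Q + Q * f j a * f a i * Q
          = Q * ((if i = j then f a a else 0) + f j i) * Q := by
        rw [← h]; noncomm_ring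
      have hz : Q * f j i * Q = 0 := by
        rw [← hc, mul_assoc _ (f a a), hf.diag_mul_eq_zero (Ne.symm hj) (Ne.symm hi)]; simp
      rw [hl j hj, zero_mul, zero_mul, add_zero] at key
      rw [key, mul_add, add_mul, hz, add_zero]
      split_ifs
      · rw [hc, hq]
      · simp

lemma corner_row_row_corner (hf : IsJordanMatrixUnits f) {a b : ι} (hab : a ≠ b) (i j : ι) :
    f a b * f b b * f b a * f a i * f a j * (f b a * f b b * f a b) = 0 := by
  have hc := hf.corner_mul_diag hab
  have hd := hf.transpose.diag_mul_corner hab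
  have hQR := hf.corner_mul_corner hab
  set Q := f a b * f b b * f b a
  set R := f b a * f b b * f a b
  by_cases hj : j = a
  · subst hj
    rw [mul_assoc, hd]
    by_cases hi : i = j
    · subst hi; rw [hc, hQR]
    · have h : Q * f j j * f j i * (f j j * R) = Q * (f j j * f j i * f j j) * R := by
        noncomm_ring
      rwa [hc, hd, hf.diag_mul_mul_diag (Ne.symm hi), mul_zero, zero_mul] at h
  · have hR : f a j * R = f j j * (f a j * R) := by
      nth_rw 1 [← hd]
      rw [← mul_assoc, ← hf.col_diag_mul (Ne.symm hj), mul_assoc]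
    by_cases hi : i = a
    · subst hi
      rw [hc, mul_assoc, hR, ← hc, mul_assoc Q, ← mul_assoc (f i i),
        hf.diag_mul_eq_zero (Ne.symm hj) (Ne.symm hj)]
      simp
    · have hQ : Q * f a i = Q * f a i * f i i := by
        rw [mul_assoc Q, ← hf.row_diag_mul (Ne.symm hi), ← mul_assoc, hc]
      by_cases hij : i = j
      · subst hij
        rw [mul_assoc Q, hf.sq_eq_zero (Ne.symm hi)]; simp
      · rw [hQ, mul_assoc _ _ R, hR, mul_assoc _ (f i i), ← mul_assoc (f i i),
          hf.diag_mul_eq_zero hij hij]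
        simp

lemma eq_corner_add_corner (hf : IsJordanMatrixUnits f) {a b : ι} (hab : a ≠ b) (i j : ι) :
    f i j = f i a * (f a b * f b b * f b a) * f a j +
      f a j * (f b a * f b b * f a b) * f i a := by
  have hsum := hf.corner_add_corner hab
  have hc := hf.corner_mul_diag hab
  have hd := hf.diag_mul_corner hab
  have hc' := hf.transpose.corner_mul_diag hab
  have hd' := hf.transpose.diag_mul_corner hab
  have hl := fun j (hj : j ≠ a) => hf.corner_mul_col hab hj
  have hr := fun j (hj : j ≠ a) => hf.row_mul_corner hab hj
  have hl' := fun j (hj : j ≠ a) => hf.transpose.corner_mul_col hab hj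
  have hr' := fun j (hj : j ≠ a) => hf.transpose.row_mul_corner hab hj
  set Q := f a b * f b b * f b a
  set R := f b a * f b b * f a b
  by_cases hi : i = a
  · subst hi
    by_cases hj : j = i
    · subst hj; rw [hd, hc, hd', hc', hsum]
    · rw [hd, mul_assoc _ R, hc']
      have e := hf.row_peirce (Ne.symm hj)
      rw [← hsum, add_mul, mul_add, hl' j hj, hr j hj, add_zero, zero_add] at e
      exact e.symm
  · by_cases hj : j = a
    · subst hj
      rw [hd', mul_assoc _ Q, hc]
      have e := hf.col_peirce hi
      rw [← hsum, add_mul, mul_add, hl i hi, hr' i hi, add_zero, zero_add, add_comm] at e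
      exact e.symm
    · have h1 : f i a * Q * f a j = f i a * f a j - f a a * f i a * f a j := by
        have : f i a * Q = f i a * f a a := by
          rw [← hsum, mul_add, hr' i hi, add_zero]
        rw [this, ← sub_mul]
        congr 1
        rw [eq_sub_iff_add_eq, add_comm, hf.col_peirce hi]
      have h2 : f a j * R * f i a = f a j * f i a - f a a * f a j * f i a := by
        have : f a j * R = f a j * f a a := by
          rw [← hsum, mul_add, hr j hj, zero_add]
        rw [this, ← sub_mul]
        congr 1
        rw [eq_sub_iff_add_eq, add_comm, hf.row_peirce (Ne.symm hj)]
      have h := hf i a a j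
      simp only [if_true] at h
      have h3 : f i j = (f i a * f a j + f a j * f i a)
          - f a a * (f i a * f a j + f a j * f i a) := by
        rw [h, mul_add, hf.diag_mul_eq_zero (Ne.symm hi) (Ne.symm hj)]
        split_ifs <;> simp [hf.idem]
      rw [h1, h2]
      nth_rw 1 [h3]
      noncomm_ring

end IsJordanMatrixUnits

section RealLinear

open ComplexStarModule Complex

lemma sum_smul_mul_sum_smul {ι A : Type*} [Fintype ι] [Ring A] [Algebra ℝ A] (c : ι → ℝ)
    (G : ι → A) (hG : ∀ i, G i * G i = G i) (hG' : ∀ i j, i ≠ j → G i * G j + G j * G i = 0) :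
    (∑ i, c i • G i) * (∑ i, c i • G i) = ∑ i, (c i * c i) • G i := by
  classical
  have h1 : (∑ i, c i • G i) * (∑ i, c i • G i) = ∑ i, ∑ j, (c i * c j) • (G i * G j) := by
    simp only [Finset.sum_mul_sum, smul_mul_smul_comm]
  have h2 : (∑ i, c i • G i) * (∑ i, c i • G i) = ∑ i, ∑ j, (c i * c j) • (G j * G i) := by
    rw [h1, Finset.sum_comm]
    simp only [mul_comm]
  have h3 : (2 : ℝ) • ((∑ i, c i • G i) * (∑ i, c i • G i))
      = (2 : ℝ) • ∑ i, (c i * c i) • G i := by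
    rw [two_smul]
    nth_rw 1 [h1]
    rw [h2, ← Finset.sum_add_distrib, Finset.smul_sum]
    refine Finset.sum_congr rfl fun i _ => ?_
    rw [← Finset.sum_add_distrib, Finset.sum_eq_single i]
    · rw [hG, two_smul]
    · intro j _ hj
      rw [← smul_add, hG' i j hj.symm, smul_zero]
    · simp
  exact smul_right_injective A (two_ne_zero : (2 : ℝ) ≠ 0) h3

variable {A B : Type*} [Ring A] [StarRing A] [Algebra ℂ A] [StarModule ℂ A]
  [Ring B] [Algebra ℂ B]

/-- The complex-linear extension of a real-linear map on self-adjoint elements. -/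
noncomputable def complexExtension (F : selfAdjoint A →ₗ[ℝ] B) : A →ₗ[ℂ] B where
  toFun x := F (ℜ x) + I • F (ℑ x)
  map_add' x y := by
    simp only [map_add, smul_add]
    abel
  map_smul' z x := by
    simp only [realPart_smul, imaginaryPart_smul, map_sub, map_add, map_smul, RingHom.id_apply]
    simp only [← Complex.coe_smul]
    conv_rhs => rw [← Complex.re_add_im z]
    match_scalars
    · ring
    · linear_combination (-z.im : ℂ) * I_mul_I

lemma complexExtension_apply (F : selfAdjoint A →ₗ[ℝ] B) (x : A) :
    complexExtension F x = F (ℜ x) + I • F (ℑ x) := rfl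

lemma complexExtension_coe (F : selfAdjoint A →ₗ[ℝ] B) (x : selfAdjoint A) :
    complexExtension F x = F x := by
  simp [complexExtension_apply]

lemma complexExtension_star [StarRing B] [StarModule ℂ B] (F : selfAdjoint A →ₗ[ℝ] B)
    (hF : ∀ x, IsSelfAdjoint (F x)) (x : A) :
    star (complexExtension F x) = complexExtension F (star x) := by
  have h1 : ℜ (star x) = ℜ x := by
    ext; simp [realPart_apply_coe, add_comm]
  have h2 : ℑ (star x) = - ℑ x := by
    ext; simp only [imaginaryPart_apply_coe, star_star, AddSubgroup.coe_neg]; module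
  simp [complexExtension_apply, h1, h2, (hF _).star_eq]

lemma complexExtension_jordan (F : selfAdjoint A →ₗ[ℝ] B)
    (hF : ∀ a c : selfAdjoint A, (c : A) = a * a → F c = F a * F a) (x y : A) :
    complexExtension F (x * y + y * x) = complexExtension F x * complexExtension F y +
      complexExtension F y * complexExtension F x := by
  have hpol : ∀ a b c : selfAdjoint A, (c : A) = a * b + b * a →
      F c = F a * F b + F b * F a := by
    intro a b c hc
    have hsq : ∀ a : selfAdjoint A, IsSelfAdjoint ((a : A) * a) := fun a => by
      simp [IsSelfAdjoint, a.2.star_eq]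
    have h1 := hF (a + b) (⟨_, hsq a⟩ + ⟨_, hsq b⟩ + c) (by
      simp only [AddSubgroup.coe_add, hc]; noncomm_ring)
    rw [map_add, map_add, hF a ⟨_, hsq a⟩ rfl, hF b ⟨_, hsq b⟩ rfl, map_add] at h1
    have : F c = (F a * F a + F b * F b + F c) - (F a * F a + F b * F b) := by abel
    rw [this, h1]
    noncomm_ring
  have hext : ∀ a b : selfAdjoint A, complexExtension F ((a : A) * b + b * a)
      = F a * F b + F b * F a := by
    intro a b
    have hab : IsSelfAdjoint ((a : A) * b + b * a) := by
      simp [IsSelfAdjoint, a.2.star_eq, b.2.star_eq, add_comm]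
    rw [← hpol a b ⟨_, hab⟩ rfl, ← complexExtension_coe]
  have hx := realPart_add_I_smul_imaginaryPart x
  have hy := realPart_add_I_smul_imaginaryPart y
  have key : x * y + y * x =
      ((ℜ x : A) * ℜ y + ℜ y * ℜ x) - ((ℑ x : A) * ℑ y + ℑ y * ℑ x)
      + I • (((ℜ x : A) * ℑ y + ℑ y * ℜ x) + ((ℑ x : A) * ℜ y + ℜ y * ℑ x)) := by
    nth_rw 1 2 [← hx, ← hy]
    simp only [mul_add, add_mul, smul_mul_assoc, mul_smul_comm]
    match_scalars <;> simp
  rw [key, map_add _ (_ - _), map_sub, map_smul, map_add _ (_ + _) (_ + _), hext, hext, hext, hext, complexExtension_apply F x,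
    complexExtension_apply F y]
  simp only [mul_add, add_mul, smul_mul_assoc, mul_smul_comm]
  match_scalars <;> simp

end RealLinear

namespace Matrix

variable {n : Type*} [Fintype n] [DecidableEq n]

lemma IsHermitian.exists_spectral_decomposition {A : Matrix n n ℂ} (hA : A.IsHermitian) :
    ∃ P : n → Matrix n n ℂ, (∀ i, (P i).IsHermitian) ∧ (∀ i, P i * P i = P i) ∧
      (∀ i j, i ≠ j → P i * P j = 0) ∧ A = ∑ i, hA.eigenvalues i • P i := by
  set U : Matrix n n ℂ := ↑hA.eigenvectorUnitary
  have hU : Uᴴ * U = 1 := Unitary.coe_star_mul_self ↑hA.eigenvectorUnitary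
  have hmul : ∀ i j, U * single i i 1 * Uᴴ * (U * single j j 1 * Uᴴ)
      = U * (single i i 1 * single j j 1) * Uᴴ := by
    intro i j
    rw [Matrix.mul_assoc _ Uᴴ, ← Matrix.mul_assoc Uᴴ, ← Matrix.mul_assoc Uᴴ, hU]
    simp only [Matrix.one_mul, Matrix.mul_assoc]
  refine ⟨fun i => U * single i i 1 * Uᴴ, fun i => ?_, fun i => ?_, fun i j hij => ?_, ?_⟩
  · exact isHermitian_mul_mul_conjTranspose _ (by simp [IsHermitian])
  · simp [hmul]
  · simp [hmul, hij]
  · have h := hA.spectral_theorem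
    rw [Unitary.conjStarAlgAut_apply] at h
    refine h.trans ?_
    rw [← sum_single_eq_diagonal, Matrix.mul_sum, Matrix.sum_mul]
    refine Finset.sum_congr rfl fun i _ => ?_
    have hs : single i i ((RCLike.ofReal ∘ hA.eigenvalues) i : ℂ)
        = hA.eigenvalues i • single i i (1 : ℂ) := by
      simp [smul_single]
    rw [hs, Matrix.mul_smul, Matrix.smul_mul]
    rfl

lemma IsHermitian.mul_self_of_spectrum_subset {A : Matrix n n ℂ} (hA : A.IsHermitian)
    (hs : spectrum ℂ A ⊆ {0, 1}) : A * A = A := by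
  obtain ⟨P, -, hP, hP', h⟩ := hA.exists_spectral_decomposition
  have hev : ∀ i, hA.eigenvalues i * hA.eigenvalues i = hA.eigenvalues i := by
    intro i
    have h1 := hs ((spectrum.algebraMap_mem_iff ℂ).mpr (hA.eigenvalues_mem_spectrum_real i))
    simp only [Complex.coe_algebraMap, Set.mem_insert_iff, Set.mem_singleton_iff,
      Complex.ofReal_eq_zero, Complex.ofReal_eq_one] at h1
    rcases h1 with h1 | h1 <;> simp [h1]
  rw [h, sum_smul_mul_sum_smul _ _ hP fun i j hij => by rw [hP' i j hij, hP' j i hij.symm, add_zero]]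
  simp only [hev]

lemma IsHermitian.exists_isometry {Q : Matrix n n ℂ} (hQ : Q.IsHermitian) (hQ' : Q * Q = Q) :
    ∃ (p : ℕ) (V : Matrix n (Fin p) ℂ), Vᴴ * V = 1 ∧ V * Vᴴ = Q := by
  have hev : ∀ i, hQ.eigenvalues i = 0 ∨ hQ.eigenvalues i = 1 := by
    intro i
    have h1 := IsIdempotentElem.spectrum_subset ℂ hQ'
      ((spectrum.algebraMap_mem_iff ℂ).mpr (hQ.eigenvalues_mem_spectrum_real i))
    simpa using h1
  set U : Matrix n n ℂ := ↑hQ.eigenvectorUnitary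
  have hU : Uᴴ * U = 1 := Unitary.coe_star_mul_self hQ.eigenvectorUnitary
  let e := (Fintype.equivFin {i // hQ.eigenvalues i = 1}).symm
  refine ⟨_, U.submatrix id fun k => (e k : n), ?_, ?_⟩
  · rw [conjTranspose_submatrix, ← submatrix_mul _ _ _ _ _ Function.bijective_id, hU]
    exact submatrix_one _ (Subtype.val_injective.comp e.injective)
  · have h := hQ.spectral_theorem
    rw [Unitary.conjStarAlgAut_apply] at h
    ext x y
    conv_rhs => rw [h]
    rw [mul_apply, mul_apply]
    simp only [mul_diagonal, submatrix_apply, conjTranspose_apply, id]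
    rw [Equiv.sum_comp e fun i : {i // hQ.eigenvalues i = 1} => U x i * star (U y i)]
    rw [← Finset.sum_subtype (Finset.univ.filter fun i => hQ.eigenvalues i = 1) (by simp)
      fun i => U x i * star (U y i), Finset.sum_filter]
    refine Finset.sum_congr rfl fun i _ => ?_
    rcases hev i with h | h <;> simp [h, U, star_apply]

end Matrix

lemma IsJordanMatrixUnits.exists_isometries {n m : Type*} [Fintype m] [DecidableEq m]
    [DecidableEq n] [Nontrivial n] {f : n → n → Matrix m m ℂ}
    (hf : IsJordanMatrixUnits f) (hstar : ∀ i j, (f i j)ᴴ = f j i) :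
    ∃ (p q : ℕ) (W : n → Matrix m (Fin p) ℂ) (Z : n → Matrix m (Fin q) ℂ),
      (∀ i j, (W i)ᴴ * W j = if i = j then 1 else 0) ∧
      (∀ i j, (Z i)ᴴ * Z j = if i = j then 1 else 0) ∧
      (∀ i j, (W i)ᴴ * Z j = 0) ∧
      (∀ i j, f i j = W i * (W j)ᴴ + Z j * (Z i)ᴴ) := by
  have : IsAddTorsionFree (Matrix m m ℂ) := inferInstanceAs (IsAddTorsionFree (m → m → ℂ))
  obtain ⟨a, b, hab⟩ := exists_pair_ne n
  have hQ := hf.corner_idem hab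
  have hR := hf.transpose.corner_idem hab
  have hQ1 := hf.corner_row_col_corner hab
  have hR1 := hf.transpose.corner_row_col_corner hab
  have hQR := hf.corner_row_row_corner hab
  have hdec := hf.eq_corner_add_corner hab
  have hQs : (f a b * f b b * f b a).IsHermitian := by
    simp [Matrix.IsHermitian, hstar, Matrix.mul_assoc]
  have hRs : (f b a * f b b * f a b).IsHermitian := by
    simp [Matrix.IsHermitian, hstar, Matrix.mul_assoc]
  obtain ⟨p, V, hV, hVQ⟩ := hQs.exists_isometry hQ
  obtain ⟨q, V', hV', hVR⟩ := hRs.exists_isometry hR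
  rw [← hVQ] at hQ1 hQR hdec
  rw [← hVR] at hR1 hQR hdec
  have sandwich : ∀ {r s : ℕ} (X : Matrix m (Fin r) ℂ) (Y : Matrix m (Fin s) ℂ)
      (B C : Matrix m m ℂ), Xᴴ * X = 1 → Yᴴ * Y = 1 →
      Xᴴ * B * (C * Y) = Xᴴ * (X * Xᴴ * B * C * (Y * Yᴴ)) * Y := by
    intro r s X Y B C hX hY
    have : Xᴴ * (X * Xᴴ * B * C * (Y * Yᴴ)) * Y = (Xᴴ * X) * Xᴴ * B * C * (Y * (Yᴴ * Y)) := by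
      simp only [Matrix.mul_assoc]
    rw [this, hX, hY, Matrix.one_mul, Matrix.mul_one]
    simp only [Matrix.mul_assoc]
  have unit : ∀ {r : ℕ} (X : Matrix m (Fin r) ℂ), Xᴴ * X = 1 → Xᴴ * (X * Xᴴ) * X = 1 := by
    intro r X hX
    rw [← Matrix.mul_assoc, hX, Matrix.one_mul, hX]
  refine ⟨p, q, fun i => f i a * V, fun i => f a i * V', fun i j => ?_, fun i j => ?_,
    fun i j => ?_, fun i j => ?_⟩
  · rw [Matrix.conjTranspose_mul, hstar, sandwich V V _ _ hV hV, hQ1]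
    split_ifs
    · exact unit V hV
    · simp
  · rw [Matrix.conjTranspose_mul, hstar, sandwich V' V' _ _ hV' hV', hR1]
    split_ifs
    · exact unit V' hV'
    · simp
  · rw [Matrix.conjTranspose_mul, hstar, sandwich V V' _ _ hV hV', hQR]
    simp
  · rw [hdec i j, Matrix.conjTranspose_mul, Matrix.conjTranspose_mul, hstar, hstar]
    simp only [Matrix.mul_assoc]

lemma IsJordanMatrixUnits.exists_blockDiagonal {n m : Type*} [Fintype m] [DecidableEq m]
    [Fintype n] [DecidableEq n] [Nontrivial n] {f : n → n → Matrix m m ℂ}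
    (hf : IsJordanMatrixUnits f) (hstar : ∀ i j, (f i j)ᴴ = f j i) (hone : ∑ i, f i i = 1) :
    ∃ (p q : ℕ) (T : Matrix m (n × Fin (p + q)) ℂ), Tᴴ * T = 1 ∧ T * Tᴴ = 1 ∧
      ∀ M : Matrix n n ℂ, ∑ i, ∑ j, M i j • f i j =
        T * Matrix.blockDiagonal (fun k : Fin (p + q) => if (k : ℕ) < p then M else Mᵀ) * Tᴴ := by
  obtain ⟨p, q, W, Z, hW, hZ, hWZ, hfWZ⟩ := hf.exists_isometries hstar
  let T : Matrix m (n × Fin (p + q)) ℂ :=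
    Matrix.of fun x ik => Fin.append (W ik.1 x) (Z ik.1 x) ik.2
  have hblock : ∀ M : Matrix n n ℂ, ∑ i, ∑ j, M i j • f i j =
      T * Matrix.blockDiagonal (fun k : Fin (p + q) => if (k : ℕ) < p then M else Mᵀ) * Tᴴ := by
    intro M
    ext x y
    have hrow : ∀ j l, (T * Matrix.blockDiagonal
        (fun k : Fin (p + q) => if (k : ℕ) < p then M else Mᵀ)) x (j, l)
        = ∑ i, T x (i, l) * (if (l : ℕ) < p then M else Mᵀ) i j := by
      intro j l
      simp [Matrix.mul_apply, Fintype.sum_prod_type, Matrix.blockDiagonal_apply]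
    rw [Matrix.mul_apply, Fintype.sum_prod_type]
    simp only [hrow, Fin.sum_univ_add]
    simp only [hfWZ, Matrix.sum_apply, Matrix.smul_apply, Matrix.add_apply, Matrix.mul_apply,
      Matrix.conjTranspose_apply, T, Matrix.of_apply, Fin.append_left, Fin.append_right,
      Fin.val_castAdd, Fin.is_lt, Fin.val_natAdd, if_true, not_lt.mpr (Nat.le_add_right p _),
      if_false, Matrix.transpose_apply, smul_add, Finset.sum_add_distrib, smul_eq_mul,
      Finset.mul_sum, Finset.sum_mul]
    congr 1
    · rw [Finset.sum_comm]
      refine Finset.sum_congr rfl fun j _ => ?_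
      rw [Finset.sum_comm]
      refine Finset.sum_congr rfl fun l _ => Finset.sum_congr rfl fun i _ => ?_
      ring
    · refine Finset.sum_congr rfl fun j _ => ?_
      rw [Finset.sum_comm]
      refine Finset.sum_congr rfl fun l _ => Finset.sum_congr rfl fun i _ => ?_
      ring
  refine ⟨p, q, T, ?_, ?_, hblock⟩
  · have hZW : ∀ i j, (Z i)ᴴ * W j = 0 := fun i j => by
      rw [← Matrix.conjTranspose_conjTranspose (W j), ← Matrix.conjTranspose_mul, hWZ]; simp
    ext ⟨i, k⟩ ⟨j, l⟩
    have e1 := fun k l => congrFun₂ (hW i j) k l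
    have e2 := fun k l => congrFun₂ (hZ i j) k l
    have e3 := fun k l => congrFun₂ (hWZ i j) k l
    have e4 := fun k l => congrFun₂ (hZW i j) k l
    simp only [Matrix.mul_apply, Matrix.conjTranspose_apply] at e1 e2 e3 e4
    simp only [Matrix.mul_apply, Matrix.conjTranspose_apply, T, Matrix.of_apply]
    induction k using Fin.addCases with
    | left k =>
      induction l using Fin.addCases with
      | left l =>
        simp only [Fin.append_left, e1]
        by_cases h : i = j <;> simp [h, Matrix.one_apply]
      | right l =>
        simp only [Fin.append_left, Fin.append_right, e3]
        rw [Matrix.one_apply_ne, Matrix.zero_apply]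
        simp [Fin.ext_iff]; omega
    | right k =>
      induction l using Fin.addCases with
      | left l =>
        simp only [Fin.append_left, Fin.append_right, e4]
        rw [Matrix.one_apply_ne, Matrix.zero_apply]
        simp [Fin.ext_iff]; omega
      | right l =>
        simp only [Fin.append_right, e2]
        by_cases h : i = j <;> simp [h, Matrix.one_apply]
  · have h := hblock 1
    have h1 : (fun k : Fin (p + q) => if (k : ℕ) < p then (1 : Matrix n n ℂ) else 1ᵀ)
        = fun _ => 1 := by
      ext; simp
    have h2 : Matrix.blockDiagonal (fun _ : Fin (p + q) => (1 : Matrix n n ℂ)) = 1 :=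
      Matrix.blockDiagonal_one
    rw [h1, h2, Matrix.mul_one] at h
    rw [← h, ← hone]
    simp [Matrix.one_apply]

/-- A convex-linear map on Hermitian matrices that vanishes at `0` is real-linear. -/
lemma exists_linearMap_of_convex {n m : Type*} (E : Matrix n n ℂ → Matrix m m ℂ) (h0 : E 0 = 0)
    (hconv : ∀ (p : ℝ), 0 ≤ p → p ≤ 1 → ∀ A B : Matrix n n ℂ,
      A.IsHermitian → B.IsHermitian →
      E (p • A + (1 - p) • B) = p • E A + (1 - p) • E B) :
    ∃ F : selfAdjoint (Matrix n n ℂ) →ₗ[ℝ] Matrix m m ℂ, ∀ A, F A = E A := by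
  have hsmul : ∀ (p : ℝ), 0 ≤ p → p ≤ 1 → ∀ A : selfAdjoint (Matrix n n ℂ),
      E (p • (A : Matrix n n ℂ)) = p • E A := by
    intro p hp hp' A
    simpa [h0] using hconv p hp hp' A 0 A.2 Matrix.isHermitian_zero
  have hadd : ∀ A B : selfAdjoint (Matrix n n ℂ), E (A + B) = E A + E B := by
    intro A B
    have h1 := hconv (1 / 2) (by norm_num) (by norm_num) A B A.2 B.2
    have h2 := hsmul (1 / 2) (by norm_num) (by norm_num) (A + B)
    have h3 : (1 - 1 / 2 : ℝ) = 1 / 2 := by norm_num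
    rw [h3, ← smul_add, ← smul_add] at h1
    rw [AddSubgroup.coe_add, h1] at h2
    exact (smul_right_injective _ (by norm_num : (1 / 2 : ℝ) ≠ 0) h2).symm
  have hpos : ∀ (p : ℝ), 0 ≤ p → ∀ A : selfAdjoint (Matrix n n ℂ),
      E (p • (A : Matrix n n ℂ)) = p • E A := by
    intro p hp A
    rcases le_total p 1 with h | h
    · exact hsmul p hp h A
    · have hp0 : p ≠ 0 := by positivity
      have h1 := hsmul p⁻¹ (by positivity) (inv_le_one_of_one_le₀ h) (p • A)
      rw [selfAdjoint.val_smul, smul_smul, inv_mul_cancel₀ hp0, one_smul] at h1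
      rw [h1, smul_smul, mul_inv_cancel₀ hp0, one_smul]
  have hneg : ∀ A : selfAdjoint (Matrix n n ℂ), E (-A) = -E A := by
    intro A
    have h1 := hadd A (-A)
    rw [AddSubgroup.coe_neg, add_neg_cancel, h0] at h1
    exact (neg_eq_of_add_eq_zero_right h1.symm).symm
  refine ⟨{ toFun := fun A => E A, map_add' := hadd, map_smul' := fun p A => ?_ }, fun A => rfl⟩
  rw [RingHom.id_apply, selfAdjoint.val_smul]
  rcases le_total 0 p with h | h
  · exact hpos p h A
  · have h1 := hpos (-p) (by linarith) (-A)
    rw [AddSubgroup.coe_neg, smul_neg, neg_smul, neg_neg, hneg] at h1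
    rw [h1]
    simp

/-- A real-linear map preserving projections preserves squares of Hermitian matrices. -/
lemma map_sq_of_map_projection {n m : Type*} [Fintype n] [DecidableEq n]
    [Fintype m] [DecidableEq m] (F : selfAdjoint (Matrix n n ℂ) →ₗ[ℝ] Matrix m m ℂ)
    (hF : ∀ P : selfAdjoint (Matrix n n ℂ), (P : Matrix n n ℂ) * P = P → F P * F P = F P)
    (A C : selfAdjoint (Matrix n n ℂ)) (hC : (C : Matrix n n ℂ) = A * A) :
    F C = F A * F A := by
  have hA : (A : Matrix n n ℂ).IsHermitian := A.2
  obtain ⟨P, hP, hPP, hPQ, hsum⟩ := hA.exists_spectral_decomposition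
  generalize hA.eigenvalues = c at hsum
  let P' : n → selfAdjoint (Matrix n n ℂ) := fun i => ⟨P i, hP i⟩
  have hA' : A = ∑ i, c i • P' i := by
    ext1
    simpa [P'] using hsum
  have hC' : C = ∑ i, (c i * c i) • P' i := by
    ext1
    rw [hC, hsum, sum_smul_mul_sum_smul _ _ hPP
      fun i j hij => by rw [hPQ i j hij, hPQ j i hij.symm, add_zero]]
    simp [P']
  have hG : ∀ i, F (P' i) * F (P' i) = F (P' i) := fun i => hF _ (hPP i)
  have hG' : ∀ i j, i ≠ j → F (P' i) * F (P' j) + F (P' j) * F (P' i) = 0 := by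
    intro i j hij
    have h := hF (P' i + P' j) (by
      simp [P', mul_add, add_mul, hPP, hPQ i j hij, hPQ j i hij.symm])
    rw [map_add, mul_add, add_mul, add_mul, hG, hG] at h
    have : F (P' i) * F (P' j) + F (P' j) * F (P' i)
      = (F (P' i) + F (P' j) * F (P' i) + (F (P' i) * F (P' j) + F (P' j)))
        - (F (P' i) + F (P' j)) := by abel
    rw [this, h, sub_self]
  have hFA : F A = ∑ i, c i • F (P' i) := by
    conv_lhs => rw [hA']
    simp
  rw [hC', hFA, sum_smul_mul_sum_smul _ _ hG hG']
  simp

/-- Characterisation of encodings: any Hermiticity-preserving, spectrum-preserving,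
convex-linear map on Hermitian matrices has the form
`M ↦ U (M^{⊕p} ⊕ M̄^{⊕q}) U†` for a unitary `U` and non-negative integers `p`, `q`. -/
theorem encoding_characterisation
    {n m : ℕ} (hn : 2 ≤ n)
    (E : Matrix (Fin n) (Fin n) ℂ → Matrix (Fin m) (Fin m) ℂ)
    (hherm : ∀ A : Matrix (Fin n) (Fin n) ℂ, A.IsHermitian → (E A).IsHermitian)
    (hspec : ∀ A : Matrix (Fin n) (Fin n) ℂ, A.IsHermitian →
      spectrum ℂ (E A) = spectrum ℂ A)
    (hconv : ∀ (p : ℝ), 0 ≤ p → p ≤ 1 → ∀ A B : Matrix (Fin n) (Fin n) ℂ,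
      A.IsHermitian → B.IsHermitian →
      E (p • A + (1 - p) • B) = p • E A + (1 - p) • E B) :
    ∃ (p q : ℕ) (_ : 1 ≤ p + q) (hm : (p + q) * n = m)
      (U : Matrix (Fin m) (Fin m) ℂ),
      U ∈ Matrix.unitaryGroup (Fin m) ℂ ∧
      ∀ M : Matrix (Fin n) (Fin n) ℂ, M.IsHermitian →
        E M = U *
          (Matrix.reindex (finProdFinEquiv.trans (finCongr ((Nat.mul_comm n (p + q)).trans hm)))
            (finProdFinEquiv.trans (finCongr ((Nat.mul_comm n (p + q)).trans hm)))
            (Matrix.blockDiagonal fun k : Fin (p + q) =>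
              if (k : ℕ) < p then M else M.map (starRingEnd ℂ))) * Uᴴ := by
  have : NeZero n := ⟨by omega⟩
  have : Nontrivial (Fin n) := Fin.nontrivial_iff_two_le.mpr hn
  have h0 : E 0 = 0 := by
    have hs := hspec 0 Matrix.isHermitian_zero
    rw [← (hherm 0 Matrix.isHermitian_zero).eigenvalues_eq_zero_iff]
    ext i
    have h1 := (spectrum.algebraMap_mem_iff ℂ).mpr
      ((hherm 0 Matrix.isHermitian_zero).eigenvalues_mem_spectrum_real i)
    rw [hs, spectrum.zero_eq] at h1
    simpa using h1
  have hproj : ∀ P : Matrix (Fin n) (Fin n) ℂ, P.IsHermitian → P * P = P → E P * E P = E P := by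
    intro P hP hPP
    refine (hherm P hP).mul_self_of_spectrum_subset ?_
    rw [hspec P hP]
    exact IsIdempotentElem.spectrum_subset ℂ hPP
  have h1 : E 1 = 1 := by
    have hu : IsUnit (E 1) := by
      rw [← spectrum.zero_notMem_iff ℂ, hspec 1 Matrix.isHermitian_one, spectrum.one_eq]
      simp
    exact hu.mul_left_cancel (by rw [hproj 1 Matrix.isHermitian_one (mul_one 1), mul_one])
  have hm0 : m ≠ 0 := by
    rintro rfl
    have hs := hspec 0 Matrix.isHermitian_zero
    rw [spectrum.zero_eq, spectrum.of_subsingleton] at hs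
    exact Set.singleton_ne_empty _ hs.symm
  obtain ⟨F, hF⟩ := exists_linearMap_of_convex E h0 hconv
  have hFsa : ∀ A, IsSelfAdjoint (F A) := fun A => by rw [hF]; exact hherm A A.2
  have hFsq := map_sq_of_map_projection F fun P hP => by rw [hF]; exact hproj P P.2 hP
  set φ := complexExtension F with hφ
  have hφE : ∀ M : Matrix (Fin n) (Fin n) ℂ, M.IsHermitian → φ M = E M := fun M hM =>
    (complexExtension_coe F ⟨M, hM⟩).trans (hF ⟨M, hM⟩)
  let f : Fin n → Fin n → Matrix (Fin m) (Fin m) ℂ := fun i j => φ (Matrix.single i j 1)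
  have hf : IsJordanMatrixUnits f := by
    intro i j k l
    rw [← complexExtension_jordan F hFsq, map_add]
    congr 1
    · split_ifs with h
      · subst h; simp [f, hφ]
      · simp [h]
    · split_ifs with h
      · subst h; simp [f, hφ]
      · simp [h]
  have hstar : ∀ i j, (f i j)ᴴ = f j i := by
    intro i j
    refine (complexExtension_star F hFsa _).trans ?_
    simp [f, Matrix.star_eq_conjTranspose, hφ]
  have hsum : ∀ M, φ M = ∑ i, ∑ j, M i j • f i j := by
    intro M
    conv_lhs => rw [Matrix.matrix_eq_sum_single M]
    simp only [map_sum, f, ← map_smul, Matrix.smul_single, smul_eq_mul, mul_one]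
  have hone : ∑ i, f i i = 1 := by
    rw [← h1, ← hφE 1 Matrix.isHermitian_one, hsum]
    simp [Matrix.one_apply]
  obtain ⟨p, q, T, hT, hT', hTM⟩ := hf.exists_blockDiagonal hstar hone
  have hm : (p + q) * n = m := by
    have := Matrix.square_of_invertible T Tᴴ hT' hT
    simpa [mul_comm] using this.symm
  refine ⟨p, q, ?_, hm, ?_⟩
  · by_contra h
    have : p + q = 0 := by omega
    rw [this, zero_mul] at hm
    exact hm0 hm.symm
  generalize finProdFinEquiv.trans (finCongr ((Nat.mul_comm n (p + q)).trans hm)) = e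
  refine ⟨T.submatrix id e.symm, ?_, fun M hM => ?_⟩
  · rw [Matrix.mem_unitaryGroup_iff, Matrix.star_eq_conjTranspose, Matrix.conjTranspose_submatrix,
      Matrix.submatrix_mul_equiv, hT', Matrix.submatrix_id_id]
  · have hMt : M.map (starRingEnd ℂ) = Mᵀ := by
      nth_rw 2 [← hM.eq]
      rfl
    rw [← hφE M hM, hsum, hTM, hMt, Matrix.reindex_apply, Matrix.conjTranspose_submatrix,
      Matrix.submatrix_mul_equiv, Matrix.submatrix_mul_equiv, Matrix.submatrix_id_id]
end

section
/- Let V : ℂⁿ ⊗ ℂᵉ → ℂᵐ be an isometry and P, Q orthogonal projectors on ℂᵉ with PQ = 0, and define ℰ(M) = V(M ⊗ P + M̄ ⊗ Q)V†, so that ℰ(1) = V(1 ⊗ (P+Q))V† is an orthogonal projector on ℂᵐ. Let Π be any orthogonal projector on ℂᵐ with ‖Π − ℰ(1)‖ < 1. Then there exists an isometry Ṽ : ℂⁿ ⊗ ℂᵉ → ℂᵐ such that ‖Ṽ − V‖ ≤ √2·‖Π − ℰ(1)‖ and the map Ẽ(M) = Ṽ(M ⊗ P + M̄ ⊗ Q)Ṽ†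 satisfies Ẽ(1) = Π. -/
open scoped Matrix Kronecker ComplexOrder

noncomputable def opNorm {m n : Type*} [Fintype m] [Fintype n] [DecidableEq n]
    (A : Matrix m n ℂ) : ℝ :=
  ‖LinearMap.toContinuousLinearMap (Matrix.toEuclideanLin A)‖

def mconj {m n : Type*} (A : Matrix m n ℂ) : Matrix m n ℂ := A.map (starRingEnd ℂ)

/-- Two projections in a C⋆-algebra at distance less than one are conjugate by a unitary `u`
with `‖u - 1‖ ≤ √2 ‖q - p‖`. -/
theorem exists_unitary_conj_eq_of_norm_sub_lt_one {A : Type*} [CStarAlgebra A] {p q : A}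
    (hp : IsStarProjection p) (hq : IsStarProjection q) (hpq : ‖q - p‖ < 1) :
    ∃ u ∈ unitary A, u * p * star u = q ∧ ‖u - 1‖ ≤ √2 * ‖q - p‖ := by
  nontriviality A
  have hpp : p * p = p := hp.isIdempotentElem
  have hqq : q * q = q := hq.isIdempotentElem
  have hps : star p = p := hp.isSelfAdjoint
  have hqs : star q = q := hq.isSelfAdjoint
  have hpp' (z : A) : p * (p * z) = p * z := by rw [← mul_assoc, hpp]
  have hqq' (z : A) : q * (q * z) = q * z := by rw [← mul_assoc, hqq]
  obtain ⟨a, ha⟩ : ∃ a, a = (q - p) * (q - p) := ⟨_, rfl⟩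
  obtain ⟨x, hx⟩ : ∃ x, x = q * p + (1 - q) * (1 - p) := ⟨_, rfl⟩
  have hxs : star x = p * q + (1 - p) * (1 - q) := by simp [hx, hps, hqs]
  have has : IsSelfAdjoint a := by simp [isSelfAdjoint_iff, ha, hps, hqs]
  have hpa : a * p = p * a := by
    simp only [ha, mul_sub, sub_mul, mul_assoc, hpp, hqq, hpp']; abel
  have hxa : a * x = x * a := by
    simp only [ha, hx, mul_sub, sub_mul, mul_add, add_mul, mul_one, one_mul, mul_assoc, hpp, hqq,
      hpp', hqq']
    abel
  have hxx : x * star x = 1 - a := by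
    rw [hxs, hx, ha]
    simp only [mul_sub, sub_mul, mul_add, add_mul, mul_one, one_mul, mul_assoc, hpp,
      hqq, hpp']
    abel
  have hxx' : star x * x = 1 - a := by
    rw [hxs, hx, ha]
    simp only [mul_sub, sub_mul, mul_add, add_mul, mul_one, one_mul, mul_assoc, hpp,
      hqq, hqq']
    abel
  have hxadd : x + star x = (1 - a) + (1 - a) := by
    rw [hxs, hx, ha]
    simp only [mul_sub, sub_mul, mul_one, one_mul, hpp, hqq]
    abel
  have hxp : x * p = q * x := by
    simp only [hx, mul_sub, sub_mul, mul_add, add_mul, mul_one, one_mul, mul_assoc, hpp, hqq,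
      hqq']
    abel
  have hna : ‖a‖ ≤ ‖q - p‖ ^ 2 := by rw [ha, sq]; exact norm_mul_le _ _
  have hspec : ∀ t ∈ spectrum ℝ a, |t| ≤ ‖q - p‖ ^ 2 := fun t ht =>
    (spectrum.norm_le_norm_of_mem ht).trans hna
  have hlt : ‖q - p‖ ^ 2 < 1 := by nlinarith [norm_nonneg (q - p)]
  have hpos : ∀ t ∈ spectrum ℝ a, 0 < 1 - t := fun t ht => by
    linarith [le_abs_self t, hspec t ht]
  have hcont : ContinuousOn (fun t : ℝ => (√(1 - t))⁻¹) (spectrum ℝ a) :=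
    ContinuousOn.inv₀ (by fun_prop) fun t ht => (Real.sqrt_pos.2 (hpos t ht)).ne'
  obtain ⟨b, hb⟩ : ∃ b, b = cfc (fun t : ℝ => (√(1 - t))⁻¹) a := ⟨_, rfl⟩
  have hbs : star b = b := by rw [hb]; exact cfc_predicate (R := ℝ) (p := IsSelfAdjoint) _ a
  have hcomm {z : A} (hz : a * z = z * a) : b * z = z * b := by
    rw [hb]; exact Commute.cfc_real hz _
  have hone : cfc (fun t : ℝ => 1 - t) a = 1 - a := by
    rw [cfc_sub (fun _ : ℝ => (1 : ℝ)) (fun t => t) a, cfc_const_one ℝ a, cfc_id' ℝ a]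
  have hba : (1 - a) * b = cfc (fun t : ℝ => √(1 - t)) a := by
    rw [← hone, hb, ← cfc_mul _ _ a (by fun_prop) hcont]
    refine cfc_congr fun t ht => ?_
    have := Real.sq_sqrt (hpos t ht).le
    have := Real.sqrt_pos.2 (hpos t ht)
    field_simp
    linarith
  have hbab : (1 - a) * b * b = 1 := by
    rw [hba, hb, ← cfc_mul _ _ a (by fun_prop) hcont, ← cfc_const_one ℝ a]
    refine cfc_congr fun t ht => ?_
    exact mul_inv_cancel₀ (Real.sqrt_pos.2 (hpos t ht)).ne'
  have hbx : b * x = x * b := hcomm hxa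
  have hbxs : b * star x = star x * b := by
    have := congrArg star hbx
    simpa [hbs] using this.symm
  have huu' : star (x * b) * (x * b) = 1 := by
    rw [star_mul, hbs, hbxs, ← hbx, mul_assoc, ← mul_assoc b, ← hbab, ← hxx', mul_assoc b b x,
      hbx, ← mul_assoc b, hbx]
    simp only [mul_assoc]
  have huu : x * b * star (x * b) = 1 := by
    rw [star_mul, hbs, hbxs, ← hbab, ← hxx, mul_assoc x b, ← mul_assoc b, hbxs]
    simp only [mul_assoc]
  refine ⟨x * b, Unitary.mem_iff.2 ⟨huu', huu⟩, ?_, ?_⟩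
  · rw [mul_assoc x, hcomm hpa, ← mul_assoc x, hxp, mul_assoc q, mul_assoc q, huu, mul_one]
  · have hsq : star (x * b - 1) * (x * b - 1) = cfc (fun t : ℝ => 2 - 2 * √(1 - t)) a := by
      have h : x * b + star (x * b) = (1 - a) * b + (1 - a) * b := by
        rw [star_mul, hbs, hbxs, ← add_mul, hxadd, add_mul]
      rw [cfc_sub (fun _ : ℝ => (2 : ℝ)) (fun t => 2 * √(1 - t)) a,
        cfc_const_mul (2 : ℝ) (fun t => √(1 - t)) a, ← hba, cfc_const (2 : ℝ) a, two_smul, ← h,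
        star_sub, star_one, sub_mul, mul_sub, huu', Algebra.algebraMap_eq_smul_one, two_smul]
      simp only [mul_one, one_mul]
      abel
    have hle : ‖x * b - 1‖ * ‖x * b - 1‖ ≤ 2 * ‖q - p‖ ^ 2 := by
      rw [← CStarRing.norm_star_mul_self, hsq]
      refine norm_cfc_le (by positivity) fun t ht => ?_
      have h1 := Real.sq_sqrt (hpos t ht).le
      have h2 := Real.sqrt_nonneg (1 - t)
      have h3 := hspec t ht
      rw [Real.norm_eq_abs, abs_le]
      obtain ⟨h4, h5⟩ := abs_le.1 h3
      constructor <;> nlinarith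
    refine abs_le_of_sq_le_sq' ?_ (by positivity) |>.2
    rw [mul_pow, Real.sq_sqrt zero_le_two]
    linarith [sq (‖x * b - 1‖)]

open scoped Matrix.Norms.L2Operator in
theorem opNorm_eq_l2_norm {m n : Type*} [Fintype m] [Fintype n] [DecidableEq n]
    (A : Matrix m n ℂ) : opNorm A = ‖A‖ := rfl

theorem isStarProjection_conj_of_isometry {m n : Type*} [Fintype m] [Fintype n] [DecidableEq n]
    {V : Matrix m n ℂ} (hV : Vᴴ * V = 1) {G : Matrix n n ℂ} (hG : IsStarProjection G) :
    IsStarProjection (V * G * Vᴴ) := by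
  have hGs : Gᴴ = G := hG.isSelfAdjoint
  have hGG : G * G = G := hG.isIdempotentElem
  refine ⟨?_, ?_⟩
  · calc V * G * Vᴴ * (V * G * Vᴴ) = V * G * (Vᴴ * V) * G * Vᴴ := by
          simp only [Matrix.mul_assoc]
      _ = V * G * Vᴴ := by rw [hV, Matrix.mul_one, Matrix.mul_assoc V, hGG]
  · simp [isSelfAdjoint_iff, Matrix.star_eq_conjTranspose, Matrix.conjTranspose_mul, hGs,
      Matrix.mul_assoc]

theorem isStarProjection_one_kronecker_add {n e : Type*} [Fintype n] [Fintype e] [DecidableEq n]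
    {P Q : Matrix e e ℂ} (hP : IsStarProjection P) (hQ : IsStarProjection Q)
    (hPQ : P * Q = 0) :
    IsStarProjection ((1 : Matrix n n ℂ) ⊗ₖ P + mconj (1 : Matrix n n ℂ) ⊗ₖ Q) := by
  have hone : mconj (1 : Matrix n n ℂ) = 1 := Matrix.map_one _ (map_zero _) (map_one _)
  have hR : IsStarProjection (P + Q) := hP.add hQ hPQ
  have hRs : (P + Q)ᴴ = P + Q := hR.isSelfAdjoint
  rw [hone, ← Matrix.kronecker_add]
  refine ⟨?_, ?_⟩
  · rw [IsIdempotentElem, ← Matrix.mul_kronecker_mul, hR.isIdempotentElem, one_mul]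
  · rw [isSelfAdjoint_iff, Matrix.star_eq_conjTranspose, Matrix.conjTranspose_kronecker, hRs,
      Matrix.conjTranspose_one]

open scoped Matrix.Norms.L2Operator in
theorem l2_norm_le_one_of_isometry {m n : Type*} [Fintype m] [Fintype n] [DecidableEq m]
    [DecidableEq n] {V : Matrix m n ℂ} (hV : Vᴴ * V = 1) : ‖V‖ ≤ 1 := by
  have h := Matrix.l2_opNorm_conjTranspose_mul_self V
  rw [hV] at h
  have h1 : ‖(1 : Matrix n n ℂ)‖ ≤ 1 := by
    cases subsingleton_or_nontrivial (Matrix n n ℂ)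
    · simp [Subsingleton.elim (1 : Matrix n n ℂ) 0]
    · exact CStarRing.norm_one.le
  nlinarith [norm_nonneg V]

/-- If the projector `ℰ(1)` of an encoding is close to a projector `Π`, the encoding
isometry `V` can be perturbed to an isometry `Ṽ` with `‖Ṽ − V‖ ≤ √2 ‖Π − ℰ(1)‖` whose
encoding satisfies `Ẽ(1) = Π`. -/
theorem perturb_encoding_isometry
    {n e m : ℕ}
    (V : Matrix (Fin m) (Fin n × Fin e) ℂ) (hV : Vᴴ * V = 1)
    (P Q : Matrix (Fin e) (Fin e) ℂ)
    (hPherm : P.IsHermitian) (hPproj : P * P = P)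
    (hQherm : Q.IsHermitian) (hQproj : Q * Q = Q) (hPQ : P * Q = 0)
    (Pr : Matrix (Fin m) (Fin m) ℂ) (hPrherm : Pr.IsHermitian) (hPrproj : Pr * Pr = Pr)
    (hclose : opNorm (Pr - V * ((1 : Matrix (Fin n) (Fin n) ℂ) ⊗ₖ P +
        mconj (1 : Matrix (Fin n) (Fin n) ℂ) ⊗ₖ Q) * Vᴴ) < 1) :
    ∃ Vt : Matrix (Fin m) (Fin n × Fin e) ℂ,
      Vtᴴ * Vt = 1 ∧
      opNorm (Vt - V) ≤ Real.sqrt 2 *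
        opNorm (Pr - V * ((1 : Matrix (Fin n) (Fin n) ℂ) ⊗ₖ P +
          mconj (1 : Matrix (Fin n) (Fin n) ℂ) ⊗ₖ Q) * Vᴴ) ∧
      Vt * ((1 : Matrix (Fin n) (Fin n) ℂ) ⊗ₖ P +
          mconj (1 : Matrix (Fin n) (Fin n) ℂ) ⊗ₖ Q) * Vtᴴ = Pr := by
  open scoped Matrix.Norms.L2Operator in
  have hG := isStarProjection_one_kronecker_add (n := Fin n) ⟨hPproj, hPherm⟩ ⟨hQproj, hQherm⟩ hPQ
  obtain ⟨G, hGdef⟩ : ∃ G, G = (1 : Matrix (Fin n) (Fin n) ℂ) ⊗ₖ P +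
      mconj (1 : Matrix (Fin n) (Fin n) ℂ) ⊗ₖ Q := ⟨_, rfl⟩
  rw [← hGdef] at hG hclose ⊢
  simp only [opNorm_eq_l2_norm] at hclose ⊢
  obtain ⟨u, hu, hconj, hnorm⟩ := exists_unitary_conj_eq_of_norm_sub_lt_one
    (isStarProjection_conj_of_isometry hV hG) ⟨hPrproj, hPrherm⟩ hclose
  have huu : uᴴ * u = 1 := Unitary.star_mul_self_of_mem hu
  refine ⟨u * V, ?_, ?_, ?_⟩
  · rw [Matrix.conjTranspose_mul, Matrix.mul_assoc, ← Matrix.mul_assoc uᴴ, huu, Matrix.one_mul, hV]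
  · calc ‖u * V - V‖ = ‖(u - 1) * V‖ := by rw [Matrix.sub_mul, Matrix.one_mul]
      _ ≤ ‖u - 1‖ * ‖V‖ := Matrix.l2_opNorm_mul _ _
      _ ≤ ‖u - 1‖ := mul_le_of_le_one_right (norm_nonneg _) (l2_norm_le_one_of_isometry hV)
      _ ≤ _ := hnorm
  · rw [← hconj, Matrix.conjTranspose_mul, Matrix.star_eq_conjTranspose]
    simp only [Matrix.mul_assoc]
end

section
/- Let H be a Hermitian N×N matrix and H' a Hermitian M×M matrix, let Δ ∈ ℝ and ε ≥ 0, let p, q be non-negative integers with p + q ≥ 1, and suppose there is an isometry Ṽ : ℂ^{N(p+q)} → ℂᴹ such that Ṽ·Ṽ† = P_{≤Δ(H')} and ‖H'·P_{≤Δ(H')} − Ṽ·(H^{⊕p} ⊕ H̄^{⊕q})·Ṽ†‖ ≤ ε, where H^{⊕p} ⊕ H̄^{⊕q} is the block-diagonal matrix with p blocks H and q blocks H̄. Let λ₁(H) ≤ … ≤ λ_N(H) and λ₁(H') ≤ … ≤ λ_M(H') be the eigenvalues of H and H' listed in non-decreasing order with multiplicity. Then for every i with 1 ≤ i ≤ N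 and every j with (i−1)(p+q)+1 ≤ j ≤ i(p+q): |λ_i(H) − λ_j(H')| ≤ ε. -/
open scoped Matrix Kronecker ComplexOrder Classical

/-- The orthogonal projector onto the span of eigenvectors of a Hermitian matrix with
eigenvalue at most `Δ` (junk value `0` on non-Hermitian matrices). -/
noncomputable def lowEnergyProj {k : Type*} [Fintype k] [DecidableEq k]
    (A : Matrix k k ℂ) (Δ : ℝ) : Matrix k k ℂ :=
  if h : A.IsHermitian then
    (h.eigenvectorUnitary : Matrix k k ℂ) *
      Matrix.diagonal (fun i => if h.eigenvalues i ≤ Δ then (1 : ℂ) else 0) *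
      star (h.eigenvectorUnitary : Matrix k k ℂ)
  else 0

/-- Projector onto the span of the first `p` standard basis vectors of `ℂ^{p+q}`. -/
noncomputable def projFirst (p q : ℕ) : Matrix (Fin (p + q)) (Fin (p + q)) ℂ :=
  Matrix.diagonal fun k => if (k : ℕ) < p then 1 else 0

/-- Projector onto the span of the last `q` standard basis vectors of `ℂ^{p+q}`. -/
noncomputable def projLast (p q : ℕ) : Matrix (Fin (p + q)) (Fin (p + q)) ℂ :=
  Matrix.diagonal fun k => if (k : ℕ) < p then 0 else 1

theorem Orthonormal.re_inner_map_le_of_mem_span {E ι : Type*} [NormedAddCommGroup E]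
    [InnerProductSpace ℂ E] [Fintype ι] {u : ι → E} (hu : Orthonormal ℂ u) (A : E →ₗ[ℂ] E)
    {c : ι → ℝ} (hA : ∀ a, A (u a) = (c a : ℂ) • u a) {C : ℝ} (hC : ∀ a, c a ≤ C) {x : E}
    (hx : x ∈ Submodule.span ℂ (Set.range u)) :
    (inner ℂ x (A x)).re ≤ C * ‖x‖ ^ 2 := by
  obtain ⟨l, rfl⟩ := (Submodule.mem_span_range_iff_exists_fun ℂ).1 hx
  have hAx : A (∑ a, l a • u a) = ∑ a, (l a * (c a : ℂ)) • u a := by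
    simp [map_sum, hA, mul_smul]
  have hnorm : ‖∑ a, l a • u a‖ ^ 2 = ∑ a, ‖l a‖ ^ 2 := by
    rw [norm_sq_eq_re_inner (𝕜 := ℂ), hu.inner_sum]
    simp only [← Complex.normSq_eq_conj_mul_self, Complex.normSq_eq_norm_sq, map_sum,
      RCLike.re_to_complex, Complex.ofReal_re]
  rw [hAx, hu.inner_sum, hnorm, Complex.re_sum, Finset.mul_sum]
  refine Finset.sum_le_sum fun a _ => ?_
  rw [← mul_assoc, ← Complex.normSq_eq_conj_mul_self, Complex.normSq_eq_norm_sq,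
    ← Complex.ofReal_mul, Complex.ofReal_re, mul_comm]
  exact mul_le_mul_of_nonneg_right (hC a) (sq_nonneg _)

theorem Orthonormal.le_re_inner_map_of_mem_span {E ι : Type*} [NormedAddCommGroup E]
    [InnerProductSpace ℂ E] [Fintype ι] {u : ι → E} (hu : Orthonormal ℂ u) (A : E →ₗ[ℂ] E)
    {c : ι → ℝ} (hA : ∀ a, A (u a) = (c a : ℂ) • u a) {C : ℝ} (hC : ∀ a, C ≤ c a) {x : E}
    (hx : x ∈ Submodule.span ℂ (Set.range u)) :
    C * ‖x‖ ^ 2 ≤ (inner ℂ x (A x)).re := by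
  have := hu.re_inner_map_le_of_mem_span (-A) (c := fun a => -c a) (C := -C)
    (by simp [hA]) (by simpa using hC) hx
  simp only [LinearMap.neg_apply, inner_neg_right, Complex.neg_re] at this
  linarith

theorem Submodule.exists_ne_zero_mem_inf_of_finrank_lt {K E : Type*} [DivisionRing K]
    [AddCommGroup E] [Module K E] [FiniteDimensional K E] {S T F : Submodule K E}
    (hS : S ≤ F) (hT : T ≤ F)
    (h : Module.finrank K F < Module.finrank K S + Module.finrank K T) :
    ∃ x ∈ S, x ∈ T ∧ x ≠ 0 := by
  have h1 := Submodule.finrank_sup_add_finrank_inf_eq S T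
  have h2 := Submodule.finrank_mono (sup_le hS hT)
  have h3 : S ⊓ T ≠ ⊥ := by
    intro h0
    rw [h0, finrank_bot] at h1
    omega
  obtain ⟨x, hx, hx0⟩ := Submodule.exists_mem_ne_zero_of_ne_bot h3
  exact ⟨x, hx.1, hx.2, hx0⟩

/-- A one-sided Weyl inequality on a subspace `F`: too many eigenvectors of `A` with eigenvalue at
most `C` and of `B` with eigenvalue at least `D` force `D ≤ C + ε` if `A` and `B` are `ε`-close. -/
theorem le_add_of_norm_map_sub_map_le {E ι κ : Type*} [NormedAddCommGroup E]
    [InnerProductSpace ℂ E] [FiniteDimensional ℂ E] [Fintype ι] [Fintype κ]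
    (F : Submodule ℂ E) {A B : E →ₗ[ℂ] E} {ε : ℝ} (hAB : ∀ x ∈ F, ‖A x - B x‖ ≤ ε * ‖x‖)
    {u : ι → E} (hu : Orthonormal ℂ u) (huF : ∀ a, u a ∈ F) {c : ι → ℝ}
    (hA : ∀ a, A (u a) = (c a : ℂ) • u a) {C : ℝ} (hC : ∀ a, c a ≤ C)
    {w : κ → E} (hw : Orthonormal ℂ w) (hwF : ∀ b, w b ∈ F) {d : κ → ℝ}
    (hB : ∀ b, B (w b) = (d b : ℂ) • w b) {D : ℝ} (hD : ∀ b, D ≤ d b)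
    (hcard : Module.finrank ℂ F < Fintype.card ι + Fintype.card κ) :
    D ≤ C + ε := by
  have hsu : Submodule.span ℂ (Set.range u) ≤ F :=
    Submodule.span_le.2 (Set.range_subset_iff.2 huF)
  have hsw : Submodule.span ℂ (Set.range w) ≤ F :=
    Submodule.span_le.2 (Set.range_subset_iff.2 hwF)
  obtain ⟨x, hxu, hxw, hx0⟩ := Submodule.exists_ne_zero_mem_inf_of_finrank_lt hsu hsw (by
    rwa [finrank_span_eq_card hu.linearIndependent, finrank_span_eq_card hw.linearIndependent])
  have h1 := hu.re_inner_map_le_of_mem_span A hA hC hxu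
  have h2 := hw.le_re_inner_map_of_mem_span B hB hD hxw
  have h3 : (inner ℂ x (B x)).re - (inner ℂ x (A x)).re ≤ ε * ‖x‖ ^ 2 := by
    rw [← Complex.sub_re, ← inner_sub_right]
    calc _ ≤ ‖inner ℂ x (B x - A x)‖ := Complex.re_le_norm _
      _ ≤ ‖x‖ * ‖B x - A x‖ := norm_inner_le_norm _ _
      _ ≤ ‖x‖ * (ε * ‖x‖) := by
        rw [norm_sub_rev]
        exact mul_le_mul_of_nonneg_left (hAB x (hsu hxu)) (norm_nonneg _)
      _ = ε * ‖x‖ ^ 2 := by ring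
  have hpos : 0 < ‖x‖ ^ 2 := by positivity
  exact le_of_mul_le_mul_right (by linarith) hpos

namespace Matrix

theorem orthonormal_toLp_col {m n : Type*} [Fintype m] [Fintype n] [DecidableEq n]
    {Q : Matrix m n ℂ}
    (hQ : Qᴴ * Q = 1) : Orthonormal ℂ fun x => WithLp.toLp 2 (Q.col x) := by
  rw [orthonormal_iff_ite]
  intro x y
  have := congrFun (congrFun hQ x) y
  rw [EuclideanSpace.inner_eq_star_dotProduct, dotProduct_comm]
  simpa [mul_apply, dotProduct, one_apply] using! this

theorem toEuclideanLin_toLp_col {l m n : Type*} [Fintype m] [DecidableEq m]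
    {A : Matrix l m ℂ} {Q : Matrix m n ℂ} {R : Matrix l n ℂ}
    (h : A * Q = R) (x : n) :
    toEuclideanLin A (WithLp.toLp 2 (Q.col x)) = WithLp.toLp 2 (R.col x) := by
  subst h
  rfl

theorem toLp_col_mul_diagonal {m n : Type*} [Fintype n] [DecidableEq n]
    (Q : Matrix m n ℂ) (d : n → ℂ) (x : n) :
    WithLp.toLp 2 ((Q * diagonal d).col x) = d x • WithLp.toLp 2 (Q.col x) := by
  ext i
  simp [mul_comm]

theorem norm_toEuclideanLin_le_opNorm {m n : Type*} [Fintype m] [Fintype n] [DecidableEq n]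
    (A : Matrix m n ℂ) (x : EuclideanSpace ℂ n) : ‖toEuclideanLin A x‖ ≤ opNorm A * ‖x‖ :=
  (LinearMap.toContinuousLinearMap (toEuclideanLin A)).le_opNorm x

theorem finrank_range_toEuclideanLin_of_isometry {m n : Type*} [Fintype m] [Fintype n]
    [DecidableEq n] {V : Matrix m n ℂ} (hV : Vᴴ * V = 1) :
    Module.finrank ℂ (LinearMap.range (toEuclideanLin V)) = Fintype.card n := by
  classical
  rw [LinearMap.finrank_range_of_inj, finrank_euclideanSpace]
  refine Function.LeftInverse.injective (g := toEuclideanLin Vᴴ) fun x => ?_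
  rw [← LinearMap.comp_apply, ← toLpLin_mul_same, hV, toLpLin_one]
  rfl

namespace IsHermitian

variable {n : Type*} [Fintype n] [DecidableEq n] {A : Matrix n n ℂ} (hA : A.IsHermitian)

/-- The unitary matrix of eigenvectors, with columns permuted by `e`. -/
noncomputable def reindexedEigenvectors (e : n ≃ n) : Matrix n n ℂ :=
  (hA.eigenvectorUnitary : Matrix n n ℂ).submatrix id e

theorem reindexedEigenvectors_conjTranspose_mul_self (e : n ≃ n) :
    (hA.reindexedEigenvectors e)ᴴ * hA.reindexedEigenvectors e = 1 := by
  have h : (hA.eigenvectorUnitary : Matrix n n ℂ)ᴴ * hA.eigenvectorUnitary = 1 :=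
    Unitary.coe_star_mul_self hA.eigenvectorUnitary
  rw [reindexedEigenvectors, conjTranspose_submatrix, ← submatrix_mul _ _ _ _ _
    Function.bijective_id, h, submatrix_one_equiv]

theorem mul_reindexedEigenvectors (e : n ≃ n) {d : n → ℝ} (hd : ∀ i, d i = hA.eigenvalues (e i)) :
    A * hA.reindexedEigenvectors e = hA.reindexedEigenvectors e * diagonal fun i => (d i : ℂ) := by
  ext i j
  have := congrFun (hA.mulVec_eigenvectorBasis (e j)) i
  rw [mul_diagonal]
  simpa [reindexedEigenvectors, mul_apply, mulVec, dotProduct, hd, mul_comm] using! this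

theorem lowEnergyProj_mul_reindexedEigenvectors (Δ : ℝ) (e : n ≃ n) {d : n → ℝ}
    (hd : ∀ i, d i = hA.eigenvalues (e i)) :
    lowEnergyProj A Δ * hA.reindexedEigenvectors e =
      hA.reindexedEigenvectors e * diagonal fun i => if d i ≤ Δ then (1 : ℂ) else 0 := by
  have h : lowEnergyProj A Δ * (hA.eigenvectorUnitary : Matrix n n ℂ) =
      hA.eigenvectorUnitary *
        diagonal (fun i => if hA.eigenvalues i ≤ Δ then (1 : ℂ) else 0) := by
    rw [lowEnergyProj, dif_pos hA, Matrix.mul_assoc, Unitary.coe_star_mul_self, Matrix.mul_one]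
  ext i j
  have := congrFun (congrFun h i) (e j)
  rw [mul_diagonal] at this ⊢
  simpa [reindexedEigenvectors, mul_apply, hd] using! this

theorem trace_lowEnergyProj (Δ : ℝ) (e : n ≃ n) {d : n → ℝ}
    (hd : ∀ i, d i = hA.eigenvalues (e i)) :
    (lowEnergyProj A Δ).trace = (Finset.univ.filter fun i => d i ≤ Δ).card := by
  rw [lowEnergyProj, dif_pos hA, trace_mul_comm, ← Matrix.mul_assoc, Unitary.coe_star_mul_self,
    Matrix.one_mul, trace_diagonal, ← e.sum_comp]
  simp [hd]

end IsHermitian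

end Matrix

theorem mconj_mul {l m n : Type*} [Fintype m] (A : Matrix l m ℂ) (B : Matrix m n ℂ) :
    mconj (A * B) = mconj A * mconj B :=
  Matrix.map_mul

theorem mconj_diagonal_ofReal {n : Type*} [DecidableEq n] (d : n → ℝ) :
    mconj (Matrix.diagonal fun i => (d i : ℂ)) = Matrix.diagonal fun i => (d i : ℂ) := by
  simp [mconj, Matrix.diagonal_map]

theorem mconj_conjTranspose {m n : Type*} (A : Matrix m n ℂ) : (mconj A)ᴴ = mconj Aᴴ := by
  ext i j
  simp [mconj]

/-- The block-diagonal matrix `A^{⊕p} ⊕ A̅^{⊕q}`. -/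
noncomputable def conjBlockSum {m n : Type*} (p q : ℕ) (A : Matrix m n ℂ) :
    Matrix (m × Fin (p + q)) (n × Fin (p + q)) ℂ :=
  A ⊗ₖ projFirst p q + mconj A ⊗ₖ projLast p q

theorem conjBlockSum_mul {l m n : Type*} [Fintype m] (p q : ℕ) (A : Matrix l m ℂ)
    (B : Matrix m n ℂ) :
    conjBlockSum p q (A * B) = conjBlockSum p q A * conjBlockSum p q B := by
  have h1 : projFirst p q * projFirst p q = projFirst p q := by simp [projFirst]
  have h2 : projLast p q * projLast p q = projLast p q := by
    simp [projLast]
  have h3 : projFirst p q * projLast p q = 0 := by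
    rw [projFirst, projLast, Matrix.diagonal_mul_diagonal, Matrix.diagonal_eq_zero]
    ext i; simp
  have h4 : projLast p q * projFirst p q = 0 := by
    rw [projFirst, projLast, Matrix.diagonal_mul_diagonal, Matrix.diagonal_eq_zero]
    ext i; simp
  simp only [conjBlockSum, Matrix.add_mul, Matrix.mul_add, ← Matrix.mul_kronecker_mul, h1, h2, h3,
    h4, mconj_mul, Matrix.kronecker_zero, add_zero, zero_add]

theorem conjBlockSum_diagonal_ofReal {n : Type*} [DecidableEq n] (p q : ℕ) (d : n → ℝ) :
    conjBlockSum p q (Matrix.diagonal fun i => (d i : ℂ)) =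
      Matrix.diagonal fun x => (d x.1 : ℂ) := by
  rw [conjBlockSum, mconj_diagonal_ofReal, projFirst, projLast,
    Matrix.diagonal_kronecker_diagonal, Matrix.diagonal_kronecker_diagonal, Matrix.diagonal_add]
  congr 1
  ext x
  split_ifs <;> simp

theorem conjBlockSum_one {n : Type*} [DecidableEq n] (p q : ℕ) :
    conjBlockSum p q (1 : Matrix n n ℂ) = 1 := by
  simpa using conjBlockSum_diagonal_ofReal p q fun _ : n => 1

theorem conjBlockSum_conjTranspose {m n : Type*} (p q : ℕ) (A : Matrix m n ℂ) :
    (conjBlockSum p q A)ᴴ = conjBlockSum p q Aᴴ := by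
  have h1 : (projFirst p q)ᴴ = projFirst p q := by
    rw [projFirst, Matrix.diagonal_conjTranspose]; congr 1; ext i; simp [apply_ite]
  have h2 : (projLast p q)ᴴ = projLast p q := by
    rw [projLast, Matrix.diagonal_conjTranspose]; congr 1; ext i; simp [apply_ite]
  simp only [conjBlockSum, Matrix.conjTranspose_add, Matrix.conjTranspose_kronecker, h1, h2,
    mconj_conjTranspose]

theorem Monotone.le_of_lt_card_filter_le {M : ℕ} {f : Fin M → ℝ} (hf : Monotone f) {Δ : ℝ}
    {l : Fin M} (hl : (l : ℕ) < (Finset.univ.filter fun i => f i ≤ Δ).card) : f l ≤ Δ := by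
  by_contra! h
  have hsub : (Finset.univ.filter fun i => f i ≤ Δ) ⊆ Finset.Iio l := by
    intro i hi
    rw [Finset.mem_Iio]
    by_contra! hli
    exact absurd ((Finset.mem_filter.1 hi).2) (not_le.2 (h.trans_le (hf hli)))
  have := Finset.card_le_card hsub
  rw [Fin.card_Iio] at this
  omega

/-- Simulation preserves eigenvalues: if `H'` simulates `H` below the cutoff `Δ` with
error `ε`, then each eigenvalue of `H` matches the corresponding `(p+q)` eigenvalues
of `H'` to within `ε`.  Here `H ⊗ₖ projFirst p q + mconj H ⊗ₖ projLast p q` is the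
block-diagonal matrix `H^{⊕p} ⊕ H̄^{⊕q}`. -/
theorem simulation_preserves_eigenvalues
    {N M p q : ℕ} (hpq : 1 ≤ p + q)
    (H : Matrix (Fin N) (Fin N) ℂ) (hH : H.IsHermitian)
    (H' : Matrix (Fin M) (Fin M) ℂ) (hH' : H'.IsHermitian)
    (Δ : ℝ) (ε : ℝ) (hε : 0 ≤ ε)
    (Vt : Matrix (Fin M) (Fin N × Fin (p + q)) ℂ) (hVt : Vtᴴ * Vt = 1)
    (hproj : Vt * Vtᴴ = lowEnergyProj H' Δ)
    (hsim : opNorm (H' * lowEnergyProj H' Δ -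
      Vt * (H ⊗ₖ projFirst p q + mconj H ⊗ₖ projLast p q) * Vtᴴ) ≤ ε)
    (lam : Fin N → ℝ) (mu : Fin M → ℝ)
    (eN : Fin N ≃ Fin N) (hlam : ∀ i, lam i = hH.eigenvalues (eN i)) (hlamMono : Monotone lam)
    (eM : Fin M ≃ Fin M) (hmu : ∀ j, mu j = hH'.eigenvalues (eM j)) (hmuMono : Monotone mu) :
    ∀ (i : Fin N) (j : Fin M),
      (i : ℕ) * (p + q) ≤ (j : ℕ) → (j : ℕ) < ((i : ℕ) + 1) * (p + q) →
      |lam i - mu j| ≤ ε := by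
  intro i j hij hji
  set F := LinearMap.range (Matrix.toEuclideanLin Vt) with hF
  have hFrank : Module.finrank ℂ F = N * (p + q) := by
    rw [hF, Matrix.finrank_range_toEuclideanLin_of_isometry hVt]
    simp
  set W := conjBlockSum p q (hH.reindexedEigenvectors eN) with hW
  have hWW : Wᴴ * W = 1 := by
    rw [hW, conjBlockSum_conjTranspose, ← conjBlockSum_mul,
      hH.reindexedEigenvectors_conjTranspose_mul_self, conjBlockSum_one]
  have hQQ : (Vt * W)ᴴ * (Vt * W) = 1 := by
    rw [Matrix.conjTranspose_mul, Matrix.mul_assoc, ← Matrix.mul_assoc Vtᴴ, hVt, Matrix.one_mul,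
      hWW]
  have hBQ : Vt * conjBlockSum p q H * Vtᴴ * (Vt * W) =
      Vt * W * Matrix.diagonal fun x : Fin N × Fin (p + q) => (lam x.1 : ℂ) := by
    rw [Matrix.mul_assoc, ← Matrix.mul_assoc Vtᴴ, hVt, Matrix.one_mul, Matrix.mul_assoc, hW,
      ← conjBlockSum_mul, hH.mul_reindexedEigenvectors eN hlam, conjBlockSum_mul,
      conjBlockSum_diagonal_ofReal, Matrix.mul_assoc]
  set U := hH'.reindexedEigenvectors eM
  have hUU : Uᴴ * U = 1 := hH'.reindexedEigenvectors_conjTranspose_mul_self eM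
  have hHU := hH'.mul_reindexedEigenvectors eM hmu
  have hPU := hH'.lowEnergyProj_mul_reindexedEigenvectors Δ eM hmu
  have hcard : (Finset.univ.filter fun l => mu l ≤ Δ).card = N * (p + q) := by
    have h1 := hH'.trace_lowEnergyProj Δ eM hmu
    rw [← hproj, Matrix.trace_mul_comm, hVt, Matrix.trace_one] at h1
    simpa using (Nat.cast_injective h1).symm
  have hlow (l : Fin M) (hl : (l : ℕ) < N * (p + q)) : mu l ≤ Δ :=
    hmuMono.le_of_lt_card_filter_le (hcard ▸ hl)
  have hQF (x) : WithLp.toLp 2 ((Vt * W).col x) ∈ F :=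
    ⟨_, Matrix.toEuclideanLin_toLp_col rfl x⟩
  have hUF (l : Fin M) (hl : (l : ℕ) < N * (p + q)) : WithLp.toLp 2 (U.col l) ∈ F := by
    refine ⟨WithLp.toLp 2 ((Vtᴴ * U).col l), ?_⟩
    rw [← hproj, Matrix.mul_assoc] at hPU
    rw [Matrix.toEuclideanLin_toLp_col hPU, Matrix.toLp_col_mul_diagonal, if_pos (hlow l hl),
      one_smul]
  have hclose : ∀ x ∈ F, ‖Matrix.toEuclideanLin H' x -
      Matrix.toEuclideanLin (Vt * conjBlockSum p q H * Vtᴴ) x‖ ≤ ε * ‖x‖ := by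
    rintro x ⟨y, rfl⟩
    have hP : H' * Vt = H' * lowEnergyProj H' Δ * Vt := by
      rw [← hproj, Matrix.mul_assoc H', Matrix.mul_assoc, hVt, Matrix.mul_one]
    have h1 : Matrix.toEuclideanLin H' (Matrix.toEuclideanLin Vt y) =
        Matrix.toEuclideanLin (H' * lowEnergyProj H' Δ) (Matrix.toEuclideanLin Vt y) := by
      simp only [← LinearMap.comp_apply, ← Matrix.toLpLin_mul_same, hP]
    rw [h1, ← LinearMap.sub_apply, ← map_sub]
    exact (Matrix.norm_toEuclideanLin_le_opNorm _ _).trans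
      (mul_le_mul_of_nonneg_right hsim (norm_nonneg _))
  have hQorth := Matrix.orthonormal_toLp_col hQQ
  have hUorth := Matrix.orthonormal_toLp_col hUU
  have hQeig (x) := (Matrix.toEuclideanLin_toLp_col hBQ x).trans
    (Matrix.toLp_col_mul_diagonal _ _ x)
  have hUeig (l) := (Matrix.toEuclideanLin_toLp_col hHU l).trans
    (Matrix.toLp_col_mul_diagonal _ _ l)
  rw [Nat.succ_mul] at hji
  have hiN : ((i : ℕ) + 1) * (p + q) ≤ N * (p + q) := Nat.mul_le_mul_right _ i.2
  rw [Nat.succ_mul] at hiN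
  have hupper : lam i ≤ mu j + ε := by
    refine le_add_of_norm_map_sub_map_le F hclose
      (hUorth.comp (Subtype.val : Finset.Iic j → Fin M) Subtype.val_injective)
      (fun l => hUF l.1 ?_) (fun l => hUeig l.1) (fun l => hmuMono (Finset.mem_Iic.1 l.2))
      (hQorth.comp (Subtype.val : (Finset.Ici i ×ˢ Finset.univ : Finset (Fin N × Fin (p + q))) → _)
        Subtype.val_injective)
      (fun x => hQF x.1) (fun x => hQeig x.1)
      (fun x => hlamMono (Finset.mem_Ici.1 (Finset.mem_product.1 x.2).1)) ?_
    · have : (l.1 : ℕ) ≤ j := Fin.le_def.1 (Finset.mem_Iic.1 l.2)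
      omega
    · rw [hFrank, Fintype.card_coe, Fintype.card_coe, Finset.card_product, Fin.card_Iic,
        Fin.card_Ici, Finset.card_univ, Fintype.card_fin, Nat.sub_mul]
      omega
  have hlower : mu j ≤ lam i + ε := by
    have hM : N * (p + q) ≤ M := by
      rw [← hFrank]
      exact (Submodule.finrank_le F).trans_eq finrank_euclideanSpace_fin
    refine le_add_of_norm_map_sub_map_le F (fun x hx => (norm_sub_rev _ _).trans_le (hclose x hx))
      (hQorth.comp (Subtype.val : (Finset.Iic i ×ˢ Finset.univ : Finset (Fin N × Fin (p + q))) → _)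
        Subtype.val_injective)
      (fun x => hQF x.1) (fun x => hQeig x.1)
      (fun x => hlamMono (Finset.mem_Iic.1 (Finset.mem_product.1 x.2).1))
      (hUorth.comp (fun l : Fin (N * (p + q) - j) => (⟨j + l, by omega⟩ : Fin M))
        (fun a b hab => by simpa [Fin.ext_iff] using hab))
      (fun l => hUF _ ?_) (fun l => hUeig _)
      (fun l => hmuMono (Fin.mk_le_mk.2 (Nat.le_add_right _ _))) ?_
    · have := l.2
      simp only
      omega
    · rw [hFrank, Fintype.card_coe, Finset.card_product, Fin.card_Iic,
        Finset.card_univ, Fintype.card_fin, Fintype.card_fin, Nat.succ_mul]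
      omega
  rw [abs_le]
  constructor <;> linarith
end
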